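/- For every integer n ≥ 1 there is a constant c(n) > 0 with the following property. Let f : S^{4n−1} → S^{2n} be a smooth map, let ω be a smooth 2n-form on S^{2n} with ∫_{S^{2n}} ω = 1, and let β be a smooth (2n−1)-form on S^{4n−1} with dβ = f*ω. If |∫_{S^{4n−1}} β ∧ f*ω| ≥ 1 (in particular, if this Hopf integral is a non-zero integer), then the 2n-dilation of f is at least c(n). -/

import Mathlib

/-!
Basic notions: the unit sphere `S^{d-1} ⊆ ℝ^d`, the norm `‖Λ^k A‖` of the induced map on
`k`-th exterior powers of a linear map between inner product spaces, and the `k`-dilation of a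
`C¹` map between unit spheres.  A (`C¹`) map from `S^{d₁-1}` to `S^{d₂-1}` is represented by a
(`C¹`) ambient map `F : ℝ^{d₁} → ℝ^{d₂}` mapping the unit sphere into the unit sphere; its
`k`-dilation only depends on the restriction of `F` to the sphere, since the derivative is
restricted to the tangent space of the sphere.
-/

open scoped RealInnerProductSpace
open Set

noncomputable section

abbrev EucA (d : ℕ) := EuclideanSpace ℝ (Fin d)

/-- The unit sphere `S^{d-1}` in `ℝ^d` (with the round metric induced from `ℝ^d`). -/
def usph (d : ℕ) : Set (EucA d) := Metric.sphere 0 1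

/-- The operator norm `‖Λ^k A‖` of the induced map on `k`-th exterior powers (with their induced
inner products): the supremum, over orthonormal `k`-frames `v` of the domain, of the `k`-volume
`√ det (⟪A vᵢ, A vⱼ⟫)` of the image frame `A v₁, …, A v_k`. -/
noncomputable def lamNorm {E F : Type*} [NormedAddCommGroup E] [InnerProductSpace ℝ E]
    [NormedAddCommGroup F] [InnerProductSpace ℝ F] (k : ℕ) (A : E →ₗ[ℝ] F) : ℝ :=
  ⨆ v : {v : Fin k → E // Orthonormal ℝ v},
    Real.sqrt (Matrix.of fun (i j : Fin k) => ⟪A (v.1 i), A (v.1 j)⟫).det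

/-- The `k`-dilation of a map of the unit sphere `S^{d-1}` into an inner product space (e.g. into
`ℝ^{d₂}`, for a map to the sphere `S^{d₂-1}`), the map being given by an ambient map `F`: the
supremum over points `x` of the sphere of `‖Λ^k df_x‖`, where `df_x` is the derivative of `F` at
`x` restricted to the tangent space `(ℝ∙x)ᗮ` of the sphere at `x`. -/
noncomputable def kDilation {d : ℕ} {F' : Type*} [NormedAddCommGroup F']
    [InnerProductSpace ℝ F'] (k : ℕ) (F : EucA d → F') : ℝ :=
  ⨆ x : usph d,
    lamNorm k ((fderiv ℝ F (x : EucA d)).toLinearMap ∘ₗ ((ℝ ∙ (x : EucA d))ᗮ).subtype)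

open MeasureTheory

/-- Pointwise evaluation (on constant vector fields) of the exterior derivative of a `k`-form
`β` on `ℝ^d`: `dβ_x(v₀,…,v_k) = ∑ᵢ (-1)ⁱ ∂_{vᵢ}(y ↦ β_y(v₀,…,v̂ᵢ,…,v_k))(x)`. -/
noncomputable def extDEval {d k : ℕ} (β : EucA d → AlternatingMap ℝ (EucA d) ℝ (Fin k))
    (x : EucA d) (v : Fin (k + 1) → EucA d) : ℝ :=
  ∑ i : Fin (k + 1), (-1 : ℝ) ^ (i : ℕ) * fderiv ℝ (fun y => β y (v ∘ i.succAbove)) x (v i)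

/-- Pointwise evaluation of the pullback `F*ω` of a `k`-form `ω` under `F`:
`(F*ω)_x(v₁,…,v_k) = ω_{F x}(dF_x v₁, …, dF_x v_k)`. -/
noncomputable def pbEval {d₁ d₂ k : ℕ} (F : EucA d₁ → EucA d₂)
    (ω : EucA d₂ → AlternatingMap ℝ (EucA d₂) ℝ (Fin k))
    (x : EucA d₁) (v : Fin k → EucA d₁) : ℝ :=
  ω (F x) fun i => fderiv ℝ F x (v i)

/-- Pointwise evaluation of the wedge product `α ∧ β` of a `p`-form and a `q`-form:
`(α ∧ β)(v) = (p! q!)⁻¹ ∑_{σ ∈ S_{p+q}} sign σ · α(v_{σ(1)},…,v_{σ(p)}) β(v_{σ(p+1)},…)`. -/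
noncomputable def wedgeEval {E : Type*} (p q : ℕ) (α : (Fin p → E) → ℝ) (β : (Fin q → E) → ℝ)
    (v : Fin (p + q) → E) : ℝ :=
  ((p.factorial * q.factorial : ℕ) : ℝ)⁻¹ *
    ∑ σ : Equiv.Perm (Fin (p + q)), ((Equiv.Perm.sign σ : ℤ) : ℝ) *
      (α (fun i => v (σ (Fin.castAdd q i))) * β fun j => v (σ (Fin.natAdd p j)))

/-- Orthogonal projection of `v` onto the tangent space of the unit sphere at `x`. -/
noncomputable def tproj {d : ℕ} (x v : EucA d) : EucA d := v - ⟪v, x⟫ • x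

/-- The density at `x ∈ S^{d-1}` of a top-degree (`k = d-1`) form `α` with respect to the
Riemannian volume of the unit sphere with its standard orientation: the unique `c` with
`α|_{T_x} = c · vol_x`, `vol_x(v₁,…,v_k) = det(x, v₁, …, v_k)` (outward normal first) being the
Riemannian volume form; `c` is computed by pairing `α` with `vol_x`, using the Parseval tight
frame of the tangent space obtained by projecting the standard basis of `ℝ^d`. -/
noncomputable def sphDensity {d k : ℕ} (h : k + 1 = d) (α : (Fin k → EucA d) → ℝ)
    (x : EucA d) : ℝ :=
  ((k.factorial : ℕ) : ℝ)⁻¹ *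
    ∑ σ : Fin k → Fin d,
      α (fun i => tproj x (EuclideanSpace.single (σ i) 1)) *
        (Matrix.of fun (i j : Fin d) =>
          (Fin.cons x fun i' : Fin k => tproj x (EuclideanSpace.single (σ i') 1) :
            Fin (k + 1) → EucA d) (Fin.cast h.symm i) j).det

/-- The integral `∫_{S^{d-1}} α` of a top-degree form over the unit sphere with its standard
orientation: the integral of its density with respect to the `(d-1)`-dimensional Hausdorff
(i.e. Riemannian surface) measure; `ρ = d - 1` is the dimension of the sphere. -/
noncomputable def sphereFormIntegral {d k : ℕ} (h : k + 1 = d) (ρ : ℝ)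
    (α : EucA d → (Fin k → EucA d) → ℝ) : ℝ :=
  ∫ x in usph d, sphDensity h (α x) x ∂μH[ρ]

section

/-- The special orthogonal group of `ℝ^d`, as a set of continuous linear endomorphisms. -/
def rotationSet (d : ℕ) : Set (EucA d →L[ℝ] EucA d) :=
  {g | (∀ x, ‖g x‖ = ‖x‖) ∧ g.det = 1}

namespace rotationSet

variable {d : ℕ} {g h : EucA d →L[ℝ] EucA d}

lemma inner_map (hg : g ∈ rotationSet d) (x y : EucA d) : ⟪g x, g y⟫ = ⟪x, y⟫ :=
  (LinearMap.norm_map_iff_inner_map_map g).1 hg.1 x y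

lemma one_mem : (1 : EucA d →L[ℝ] EucA d) ∈ rotationSet d := by
  refine ⟨fun x => rfl, ?_⟩
  simp [ContinuousLinearMap.det]

lemma comp_mem (hg : g ∈ rotationSet d) (hh : h ∈ rotationSet d) : g ∘L h ∈ rotationSet d := by
  refine ⟨fun x => by simp [hg.1, hh.1], ?_⟩
  have h1 := hg.2
  have h2 := hh.2
  simp only [ContinuousLinearMap.det] at h1 h2 ⊢
  rw [ContinuousLinearMap.toLinearMap_comp, LinearMap.det_comp, h1, h2, one_mul]

lemma mem_unitary (hg : g ∈ rotationSet d) : g ∈ unitary (EucA d →L[ℝ] EucA d) := by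
  have h1 : (ContinuousLinearMap.adjoint g) ∘L g = 1 :=
    (ContinuousLinearMap.norm_map_iff_adjoint_comp_self g).1 hg.1
  have h2 : star g * g = 1 := h1
  refine ⟨h2, ?_⟩
  have h3 : (g : EucA d →ₗ[ℝ] EucA d) ∘ₗ
      ((star g : EucA d →L[ℝ] EucA d) : EucA d →ₗ[ℝ] EucA d) = 1 := by
    rw [← Module.End.mul_eq_comp, mul_eq_one_comm, Module.End.mul_eq_comp]
    ext1 x
    exact DFunLike.congr_fun h2 x
  ext1 x
  exact DFunLike.congr_fun h3 x

lemma norm_of_mem_unitary (hg : g ∈ unitary (EucA d →L[ℝ] EucA d)) (x : EucA d) :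
    ‖g x‖ = ‖x‖ :=
  (ContinuousLinearMap.norm_map_iff_adjoint_comp_self g).2 hg.1 x

lemma isClosed : IsClosed (rotationSet d) := by
  have h1 : rotationSet d = (⋂ x, {g | ‖g x‖ = ‖x‖}) ∩ {g | g.det = 1} := by
    ext g; simp [rotationSet]
  rw [h1]
  refine IsClosed.inter (isClosed_iInter fun x => ?_) ?_
  · exact isClosed_eq (by fun_prop) continuous_const
  · exact isClosed_eq ContinuousLinearMap.continuous_det continuous_const

lemma norm_le (hg : g ∈ rotationSet d) : ‖g‖ ≤ 1 :=
  ContinuousLinearMap.opNorm_le_bound _ zero_le_one fun x => by simp [hg.1 x]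

lemma isCompact : IsCompact (rotationSet d) := by
  have : ProperSpace (EucA d →L[ℝ] EucA d) := FiniteDimensional.proper ℝ _
  refine Metric.isCompact_of_isClosed_isBounded isClosed ?_
  refine (Metric.isBounded_closedBall (x := (0 : EucA d →L[ℝ] EucA d)) (r := 1)).subset ?_
  intro g hg
  simpa using norm_le hg

end rotationSet

/-- The special orthogonal group as a subgroup of the unitary group. -/
def soSubgroup (d : ℕ) : Subgroup (unitary (EucA d →L[ℝ] EucA d)) where
  carrier := {u | (u : EucA d →L[ℝ] EucA d) ∈ rotationSet d}
  mul_mem' := fun ha hb => rotationSet.comp_mem ha hb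
  one_mem' := rotationSet.one_mem
  inv_mem' := by
    intro u hu
    refine ⟨fun x => rotationSet.norm_of_mem_unitary (u⁻¹).2 x, ?_⟩
    have h1 : ((u⁻¹ : unitary (EucA d →L[ℝ] EucA d)) : EucA d →L[ℝ] EucA d) ∘L
      (u : EucA d →L[ℝ] EucA d) = 1 := by
        have := congrArg Subtype.val (inv_mul_cancel u)
        exact this
    have h2 := congrArg ContinuousLinearMap.det h1
    have h3 : (u : EucA d →L[ℝ] EucA d).det = 1 := hu.2
    simp only [ContinuousLinearMap.det] at h2 h3 ⊢
    rw [ContinuousLinearMap.toLinearMap_comp, LinearMap.det_comp, h3, mul_one] at h2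
    rw [h2]
    simp

/-- There is a probability measure on the rotations that is invariant under right translations. -/
theorem exists_rotation_measure (d : ℕ) :
    ∃ μ : Measure (EucA d →L[ℝ] EucA d), IsProbabilityMeasure μ ∧
      (∀ᵐ g ∂μ, g ∈ rotationSet d) ∧
      ∀ h ∈ rotationSet d, μ.map (fun g => g ∘L h) = μ := by
  let : MeasurableSpace (soSubgroup d) := borel _
  have : BorelSpace (soSubgroup d) := ⟨rfl⟩
  let ι : soSubgroup d → (EucA d →L[ℝ] EucA d) := fun u => (u.1 : EucA d →L[ℝ] EucA d)
  have hι : Topology.IsInducing ι :=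
    Topology.IsInducing.subtypeVal.comp Topology.IsInducing.subtypeVal
  have hrange : range ι = rotationSet d := by
    ext g
    constructor
    · rintro ⟨u, rfl⟩
      exact u.2
    · intro hg
      exact ⟨⟨⟨g, rotationSet.mem_unitary hg⟩, hg⟩, rfl⟩
  have : CompactSpace (soSubgroup d) := by
    rw [← isCompact_univ_iff, hι.isCompact_iff, image_univ, hrange]
    exact rotationSet.isCompact
  have : SecondCountableTopology (EucA d →L[ℝ] EucA d) := by
    have : ProperSpace (EucA d →L[ℝ] EucA d) := FiniteDimensional.proper ℝ _
    infer_instance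
  have : SecondCountableTopology (soSubgroup d) := hι.secondCountableTopology
  have : ContinuousStar (EucA d →L[ℝ] EucA d) :=
    ⟨(ContinuousLinearMap.adjoint (𝕜 := ℝ) (E := EucA d) (F := EucA d)).continuous⟩
  have : IsTopologicalGroup (soSubgroup d) := inferInstance
  let K : TopologicalSpace.PositiveCompacts (soSubgroup d) := ⊤
  let ν : Measure (soSubgroup d) := (Measure.haarMeasure K).inv
  have hν : IsProbabilityMeasure ν := by
    constructor
    rw [Measure.inv_apply]
    simpa [K] using Measure.haarMeasure_self (K₀ := K)
  have hιm : Measurable ι := hι.continuous.measurable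
  refine ⟨ν.map ι, Measure.isProbabilityMeasure_map hιm.aemeasurable, ?_, ?_⟩
  · refine (ae_map_iff (p := fun g => g ∈ rotationSet d) hιm.aemeasurable
      rotationSet.isClosed.measurableSet).2 ?_
    exact Filter.Eventually.of_forall fun u => u.2
  · intro h hh
    let h' : soSubgroup d := ⟨⟨h, rotationSet.mem_unitary hh⟩, hh⟩
    have hc : Measurable fun g : EucA d →L[ℝ] EucA d => g ∘L h :=
      (by fun_prop : Continuous fun g : EucA d →L[ℝ] EucA d => g ∘L h).measurable
    rw [Measure.map_map hc hιm]
    have : (fun g : EucA d →L[ℝ] EucA d => g ∘L h) ∘ ι = ι ∘ fun u => u * h' := rfl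
    rw [this, ← Measure.map_map hιm (measurable_mul_const h'), map_mul_right_eq_self]

/-- A right-invariant probability measure on the rotations of `ℝ^d`. -/
def rotMeasure (d : ℕ) : Measure (EucA d →L[ℝ] EucA d) := (exists_rotation_measure d).choose

instance (d : ℕ) : IsProbabilityMeasure (rotMeasure d) :=
  (exists_rotation_measure d).choose_spec.1

lemma rotMeasure_ae (d : ℕ) : ∀ᵐ g ∂(rotMeasure d), g ∈ rotationSet d :=
  (exists_rotation_measure d).choose_spec.2.1

lemma rotMeasure_restrict (d : ℕ) : (rotMeasure d).restrict (rotationSet d) = rotMeasure d :=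
  Measure.restrict_eq_self_of_ae_mem (rotMeasure_ae d)

lemma integral_comp_right {d : ℕ} {F : Type*} [NormedAddCommGroup F] [NormedSpace ℝ F]
    {h : EucA d →L[ℝ] EucA d} (hh : h ∈ rotationSet d)
    {f : (EucA d →L[ℝ] EucA d) → F} (hf : Continuous f) :
    ∫ g, f (g ∘L h) ∂(rotMeasure d) = ∫ g, f g ∂(rotMeasure d) := by
  have hc : Measurable fun g : EucA d →L[ℝ] EucA d => g ∘L h :=
      (by fun_prop : Continuous fun g : EucA d →L[ℝ] EucA d => g ∘L h).measurable
  have h1 := (exists_rotation_measure d).choose_spec.2.2 h hh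
  change (rotMeasure d).map _ = rotMeasure d at h1
  have : SecondCountableTopology (EucA d →L[ℝ] EucA d) := by
    have : ProperSpace (EucA d →L[ℝ] EucA d) := FiniteDimensional.proper ℝ _
    infer_instance
  conv_rhs => rw [← h1]
  rw [integral_map hc.aemeasurable hf.aestronglyMeasurable]

lemma integrable_rot {d : ℕ} {F : Type*} [NormedAddCommGroup F] [NormedSpace ℝ F]
    {f : (EucA d →L[ℝ] EucA d) → F} (hf : Continuous f) :
    Integrable f (rotMeasure d) := by
  rw [← rotMeasure_restrict]
  exact hf.continuousOn.integrableOn_compact rotationSet.isCompact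

end

section

variable {d : ℕ}

/-- Infinitesimal generator of the rotation taking `u` to `w`. -/
def planeGen (u w : EucA d) : EucA d →L[ℝ] EucA d :=
  (innerSL ℝ u).smulRight w - (innerSL ℝ w).smulRight u

/-- Rotation by the angle `t` in the oriented plane spanned by the orthonormal pair `u, w`. -/
def planeRot (u w : EucA d) (t : ℝ) : EucA d →L[ℝ] EucA d :=
  1 + (Real.cos t - 1) • ((innerSL ℝ u).smulRight u + (innerSL ℝ w).smulRight w) +
    Real.sin t • planeGen u w

lemma planeGen_apply (u w x : EucA d) : planeGen u w x = ⟪u, x⟫ • w - ⟪w, x⟫ • u := by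
  simp [planeGen]

lemma planeRot_apply (u w : EucA d) (t : ℝ) (x : EucA d) :
    planeRot u w t x = x + (Real.cos t - 1) • (⟪u, x⟫ • u + ⟪w, x⟫ • w) +
      Real.sin t • (⟪u, x⟫ • w - ⟪w, x⟫ • u) := by
  simp [planeRot, planeGen_apply]

/-- An orthonormal pair of vectors. -/
structure OrthoPair (u w : EucA d) : Prop where
  left : ⟪u, u⟫ = 1
  right : ⟪w, w⟫ = 1
  ortho : ⟪u, w⟫ = 0

namespace OrthoPair

variable {u w : EucA d}

lemma ortho' (h : OrthoPair u w) : ⟪w, u⟫ = 0 := by rw [real_inner_comm]; exact h.ortho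

lemma inner_left_rot (h : OrthoPair u w) (t : ℝ) (x : EucA d) :
    ⟪u, planeRot u w t x⟫ = Real.cos t * ⟪u, x⟫ - Real.sin t * ⟪w, x⟫ := by
  rw [planeRot_apply]
  simp only [inner_add_right, inner_sub_right, real_inner_smul_right, h.left, h.ortho]
  ring

lemma inner_right_rot (h : OrthoPair u w) (t : ℝ) (x : EucA d) :
    ⟪w, planeRot u w t x⟫ = Real.sin t * ⟪u, x⟫ + Real.cos t * ⟪w, x⟫ := by
  rw [planeRot_apply]
  simp only [inner_add_right, inner_sub_right, real_inner_smul_right, h.right, h.ortho']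
  ring

lemma rot_add (h : OrthoPair u w) (s t : ℝ) :
    planeRot u w (s + t) = planeRot u w s ∘L planeRot u w t := by
  ext1 x
  rw [ContinuousLinearMap.comp_apply, planeRot_apply u w s, h.inner_left_rot, h.inner_right_rot,
    planeRot_apply u w t, planeRot_apply, Real.cos_add, Real.sin_add]
  module

lemma rot_left (h : OrthoPair u w) (t : ℝ) :
    planeRot u w t u = Real.cos t • u + Real.sin t • w := by
  rw [planeRot_apply, h.left, h.ortho']
  module

lemma rot_right (h : OrthoPair u w) (t : ℝ) :
    planeRot u w t w = Real.cos t • w - Real.sin t • u := by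
  rw [planeRot_apply, h.right, h.ortho]
  module

lemma rot_of_ortho {x : EucA d} (hu : ⟪u, x⟫ = 0) (hw : ⟪w, x⟫ = 0) (t : ℝ) :
    planeRot u w t x = x := by
  rw [planeRot_apply, hu, hw]
  module

lemma norm_rot (h : OrthoPair u w) (t : ℝ) (x : EucA d) : ‖planeRot u w t x‖ = ‖x‖ := by
  have h1 : ⟪planeRot u w t x, planeRot u w t x⟫ = ⟪x, x⟫ := by
    simp only [planeRot_apply, inner_add_left, inner_sub_left, real_inner_smul_left,
      inner_add_right, inner_sub_right, real_inner_smul_right, h.left, h.right, h.ortho, h.ortho',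
      real_inner_comm u x, real_inner_comm w x]
    linear_combination (⟪u, x⟫ ^ 2 + ⟪w, x⟫ ^ 2) * Real.sin_sq_add_cos_sq t
  rw [real_inner_self_eq_norm_sq, real_inner_self_eq_norm_sq] at h1
  exact (sq_eq_sq₀ (norm_nonneg _) (norm_nonneg _)).1 h1

lemma rot_mem (h : OrthoPair u w) (t : ℝ) : planeRot u w t ∈ rotationSet d := by
  refine ⟨h.norm_rot t, ?_⟩
  have h1 : |(planeRot u w (t / 2)).det| = 1 := by
    rw [ContinuousLinearMap.det, ← LinearMap.normDet_eq_abs_det]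
    exact LinearIsometry.normDet_eq_one
      (⟨(planeRot u w (t / 2)).toLinearMap, h.norm_rot (t / 2)⟩ : EucA d →ₗᵢ[ℝ] EucA d)
  have h2 := h.rot_add (t / 2) (t / 2)
  rw [add_halves] at h2
  rw [h2, ContinuousLinearMap.det, ContinuousLinearMap.toLinearMap_comp, LinearMap.det_comp]
  change (planeRot u w (t / 2)).det * (planeRot u w (t / 2)).det = 1
  rw [← abs_mul_abs_self, h1, one_mul]

lemma hasDerivAt_rot (h : OrthoPair u w) (t : ℝ) :
    HasDerivAt (planeRot u w) (planeRot u w t ∘L planeGen u w) t := by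
  have h1 : HasDerivAt (planeRot u w)
      ((-Real.sin t) • ((innerSL ℝ u).smulRight u + (innerSL ℝ w).smulRight w) +
        Real.cos t • planeGen u w) t := by
    have h2 := ((Real.hasDerivAt_cos t).sub_const 1).smul_const
      ((innerSL ℝ u).smulRight u + (innerSL ℝ w).smulRight w)
    have h3 := (Real.hasDerivAt_sin t).smul_const (planeGen u w)
    exact (h2.const_add (1 : EucA d →L[ℝ] EucA d)).add h3
  convert h1 using 1
  ext1 x
  rw [ContinuousLinearMap.comp_apply, planeRot_apply]
  simp only [planeGen_apply, inner_sub_right, real_inner_smul_right, h.left, h.right, h.ortho,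
    h.ortho', add_apply, smul_apply,
    ContinuousLinearMap.smulRight_apply, innerSL_apply_apply]
  module

lemma inner_gen (x : EucA d) : ⟪planeGen u w x, x⟫ = 0 := by
  rw [planeGen_apply, inner_sub_left, real_inner_smul_left, real_inner_smul_left]
  ring

lemma norm_gen_le (h : OrthoPair u w) (x : EucA d) : ‖planeGen u w x‖ ≤ ‖x‖ := by
  have h1 : 0 ≤ ⟪x - ⟪u, x⟫ • u - ⟪w, x⟫ • w, x - ⟪u, x⟫ • u - ⟪w, x⟫ • w⟫ :=
    real_inner_self_nonneg
  have h2 : ⟪planeGen u w x, planeGen u w x⟫ = ⟪u, x⟫ ^ 2 + ⟪w, x⟫ ^ 2 := by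
    rw [planeGen_apply]
    simp only [inner_sub_left, inner_sub_right, real_inner_smul_left, real_inner_smul_right,
      h.left, h.right, h.ortho, h.ortho']
    ring
  simp only [inner_sub_left, inner_sub_right, real_inner_smul_left, real_inner_smul_right,
      h.left, h.right, h.ortho, h.ortho', real_inner_comm u x, real_inner_comm w x] at h1
  rw [real_inner_self_eq_norm_sq] at h1 h2
  refine (sq_le_sq₀ (norm_nonneg _) (norm_nonneg _)).1 ?_
  rw [h2]
  linarith

end OrthoPair

lemma planeRot_zero (u w : EucA d) : planeRot u w 0 = 1 := by
  ext1 x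
  rw [planeRot_apply]
  simp

/-- Products of at most `n` plane rotations. -/
def rotWord (d : ℕ) : ℕ → Set (EucA d →L[ℝ] EucA d)
  | 0 => {1}
  | n + 1 => {a | ∃ r ∈ rotWord d n, a = r ∨
      ∃ u w t, OrthoPair u w ∧ 0 ≤ t ∧ t ≤ 2 * Real.pi ∧ a = planeRot u w t ∘L r}

lemma rotWord_mono {n m : ℕ} (h : n ≤ m) : rotWord d n ⊆ rotWord d m := by
  induction h with
  | refl => exact subset_rfl
  | step _ ih => exact fun a ha => ⟨a, ih ha, Or.inl rfl⟩

lemma rotWord_subset (n : ℕ) : rotWord d n ⊆ rotationSet d := by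
  induction n with
  | zero =>
    rintro a rfl
    exact rotationSet.one_mem
  | succ n ih =>
    rintro a ⟨r, hr, rfl | ⟨u, w, t, h, -, -, rfl⟩⟩
    · exact ih hr
    · exact rotationSet.comp_mem (h.rot_mem t) (ih hr)

/-- Reflection along a unit vector. -/
def unitRefl (v : EucA d) : EucA d →L[ℝ] EucA d := 1 - (2 : ℝ) • (innerSL ℝ v).smulRight v

lemma unitRefl_apply (v x : EucA d) : unitRefl v x = x - (2 * ⟪v, x⟫) • v := by
  simp [unitRefl, mul_smul]

lemma unitRefl_comp {u v : EucA d} (hu : ⟪u, u⟫ = 1) (hv : ⟪v, v⟫ = 1) :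
    unitRefl u ∘L unitRefl v = 1 ∨ ∃ w t, OrthoPair v w ∧ 0 ≤ t ∧ t ≤ 2 * Real.pi ∧
      unitRefl u ∘L unitRefl v = planeRot v w t := by
  set c := ⟪u, v⟫ with hc
  have hc' : ⟪v, u⟫ = c := real_inner_comm _ _
  set r := u - c • v with hr
  have hrr : ⟪r, r⟫ = 1 - c ^ 2 := by
    simp only [hr, inner_sub_left, inner_sub_right, real_inner_smul_left, real_inner_smul_right,
      hu, hv, hc', ← hc]
    ring
  have hvr : ⟪v, r⟫ = 0 := by
    simp only [hr, inner_sub_right, real_inner_smul_right, hv, hc']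
    ring
  have hur : u = c • v + r := by rw [hr]; module
  by_cases h0 : r = 0
  · left
    rw [h0, inner_zero_left] at hrr
    rw [h0, add_zero] at hur
    ext1 x
    simp only [ContinuousLinearMap.comp_apply, unitRefl_apply, inner_sub_right,
      real_inner_smul_right]
    rw [hur, real_inner_smul_left, real_inner_smul_left, hv, smul_smul, sub_sub, ← add_smul]
    have : 2 * ⟪v, x⟫ + 2 * (c * ⟪v, x⟫ - 2 * ⟪v, x⟫ * (c * 1)) * c = 0 := by
      linear_combination (-2 * ⟪v, x⟫) * hrr
    rw [this]
    simp
  · right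
    have hn : 0 < ‖r‖ := norm_pos_iff.2 h0
    have hn2 : ‖r‖ ^ 2 = 1 - c ^ 2 := by rw [← real_inner_self_eq_norm_sq, hrr]
    have hc1 : c ^ 2 ≤ 1 := by nlinarith [sq_nonneg ‖r‖]
    have hcl : -1 ≤ c := by nlinarith
    have hcu : c ≤ 1 := by nlinarith
    have hsin : Real.sin (Real.arccos c) = ‖r‖ := by
      rw [Real.sin_arccos, ← hn2, Real.sqrt_sq hn.le]
    have hcos : Real.cos (Real.arccos c) = c := Real.cos_arccos hcl hcu
    refine ⟨‖r‖⁻¹ • r, 2 * Real.arccos c, ⟨hv, ?_, ?_⟩, ?_, ?_, ?_⟩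
    · rw [real_inner_smul_left, real_inner_smul_right, real_inner_self_eq_norm_sq]
      field_simp
    · rw [real_inner_smul_right, hvr, mul_zero]
    · have := Real.arccos_nonneg c; linarith
    · have := Real.arccos_le_pi c; linarith
    · ext1 x
      set w := ‖r‖⁻¹ • r with hw
      have hrw : r = ‖r‖ • w := by rw [hw, smul_smul, mul_inv_cancel₀ hn.ne', one_smul]
      rw [planeRot_apply, Real.cos_two_mul, Real.sin_two_mul, hcos, hsin,
        ContinuousLinearMap.comp_apply, unitRefl_apply v x, unitRefl_apply]
      have e1 : ⟪u, x - (2 * ⟪v, x⟫) • v⟫ = ‖r‖ * ⟪w, x⟫ - c * ⟪v, x⟫ := by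
        rw [inner_sub_right, real_inner_smul_right, ← hc, hur, hrw, inner_add_left,
          real_inner_smul_left, real_inner_smul_left, norm_smul, norm_norm]
        have : ‖w‖ = 1 := by
          rw [hw, norm_smul, norm_inv, norm_norm, inv_mul_cancel₀ hn.ne']
        rw [this]; ring
      have hc2 : c ^ 2 = 1 - ‖r‖ ^ 2 := by linarith
      have huw : u = c • v + ‖r‖ • w := hur.trans (by rw [← hrw])
      rw [e1, huw]
      generalize ‖r‖ = ρ at hc2
      clear_value w c
      match_scalars
      · ring
      · ring
      · linear_combination (-2 * ⟪w, x⟫) * hc2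

lemma reflection_eq_unitRefl {v : EucA d} (hv : v ≠ 0) :
    (((ℝ ∙ v)ᗮ.reflection : EucA d ≃ₗᵢ[ℝ] EucA d) : EucA d →L[ℝ] EucA d) =
      unitRefl (‖v‖⁻¹ • v) := by
  ext1 x
  have hn : ‖v‖ ≠ 0 := norm_ne_zero_iff.2 hv
  rw [unitRefl_apply]
  change (ℝ ∙ v)ᗮ.reflection x = _
  rw [Submodule.reflection_orthogonal_apply, Submodule.reflection_singleton_apply,
    real_inner_smul_left]
  simp only [RCLike.ofReal_real_eq_id, id]
  match_scalars <;> field_simp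

theorem rotationSet_subset_rotWord : rotationSet d ⊆ rotWord d d := by
  have key : ∀ l : List (EucA d), ∃ r ∈ rotWord d l.length,
      (((l.map fun v => (ℝ ∙ v)ᗮ.reflection).prod : EucA d ≃ₗᵢ[ℝ] EucA d) :
        EucA d →L[ℝ] EucA d) = r ∨
      ∃ u, ⟪u, u⟫ = 1 ∧ (((l.map fun v => (ℝ ∙ v)ᗮ.reflection).prod : EucA d ≃ₗᵢ[ℝ] EucA d) :
        EucA d →L[ℝ] EucA d) = unitRefl u ∘L r := by
    intro l
    induction l with
    | nil => exact ⟨1, rfl, Or.inl rfl⟩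
    | cons v l ih =>
      obtain ⟨r, hr, h⟩ := ih
      have e : (((((v :: l).map fun v => (ℝ ∙ v)ᗮ.reflection)).prod : EucA d ≃ₗᵢ[ℝ] EucA d) :
        EucA d →L[ℝ] EucA d) = (((ℝ ∙ v)ᗮ.reflection : EucA d ≃ₗᵢ[ℝ] EucA d) :
          EucA d →L[ℝ] EucA d) ∘L (((l.map fun v => (ℝ ∙ v)ᗮ.reflection).prod :
            EucA d ≃ₗᵢ[ℝ] EucA d) : EucA d →L[ℝ] EucA d) := by
        rw [List.map_cons, List.prod_cons]
        rfl
      rw [e, List.length_cons]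
      by_cases hv : v = 0
      · have : (((ℝ ∙ v)ᗮ.reflection : EucA d ≃ₗᵢ[ℝ] EucA d) : EucA d →L[ℝ] EucA d) = 1 := by
          subst hv
          ext1 x
          change (ℝ ∙ (0 : EucA d))ᗮ.reflection x = x
          rw [Submodule.reflection_orthogonal_apply, Submodule.reflection_singleton_apply]
          simp
        rw [this]
        exact ⟨r, rotWord_mono (Nat.le_succ _) hr, h⟩
      · rw [reflection_eq_unitRefl hv]
        have hv1 : ⟪‖v‖⁻¹ • v, ‖v‖⁻¹ • v⟫ = 1 := by
          have hn : ‖v‖ ≠ 0 := norm_ne_zero_iff.2 hv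
          rw [real_inner_smul_left, real_inner_smul_right, real_inner_self_eq_norm_sq]
          field_simp
        rcases h with h | ⟨u, hu, h⟩
        · exact ⟨r, rotWord_mono (Nat.le_succ _) hr, Or.inr ⟨_, hv1, by rw [h]⟩⟩
        · rw [h, ← ContinuousLinearMap.comp_assoc]
          rcases unitRefl_comp hv1 hu with h' | ⟨w, t, h1, h2, h3, h4⟩
          · refine ⟨r, rotWord_mono (Nat.le_succ _) hr, Or.inl ?_⟩
            rw [h']
            rfl
          · exact ⟨planeRot u w t ∘L r, ⟨r, hr, Or.inr ⟨u, w, t, h1, h2, h3, rfl⟩⟩,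
              Or.inl (by rw [h4])⟩
  intro a ha
  let φ : EucA d ≃ₗᵢ[ℝ] EucA d := Unitary.linearIsometryEquiv ⟨a, rotationSet.mem_unitary ha⟩
  have hφ : (φ : EucA d →L[ℝ] EucA d) = a := rfl
  obtain ⟨l, hl, he⟩ := φ.reflections_generate_dim
  rw [finrank_euclideanSpace_fin] at hl
  obtain ⟨r, hr, h⟩ := key l
  rw [← he, hφ] at h
  rcases h with h | ⟨u, hu, h⟩
  · rw [h]
    exact rotWord_mono hl hr
  · exfalso
    have h1 := ha.2
    have hu0 : u ≠ 0 := by rintro rfl; simp at hu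
    have hun : ‖u‖ = 1 := by
      rw [real_inner_self_eq_norm_sq] at hu
      nlinarith [norm_nonneg u]
    have h3 : (unitRefl u).det = -1 := by
      have := reflection_eq_unitRefl hu0
      rw [hun, inv_one, one_smul] at this
      rw [← this]
      have h5 := Submodule.det_reflection (𝕜 := ℝ) (ℝ ∙ u)ᗮ
      rw [Submodule.orthogonal_orthogonal, finrank_span_singleton hu0, pow_one] at h5
      exact h5
    have h2 := (rotWord_subset _ hr).2
    rw [h, ContinuousLinearMap.det, ContinuousLinearMap.toLinearMap_comp, LinearMap.det_comp] at h1
    change (unitRefl u).det * r.det = 1 at h1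
    rw [h2, h3] at h1
    norm_num at h1

end

section

lemma alternatingMap_matrix {k : ℕ} {E : Type*} [AddCommGroup E] [Module ℝ E]
    (α : E [⋀^Fin k]→ₗ[ℝ] ℝ) (f : Fin k → E) (A : Matrix (Fin k) (Fin k) ℝ) :
    α (fun i => ∑ j, A i j • f j) = A.det * α f := by
  have h := (α.compLinearMap (Fintype.linearCombination ℝ f)).eq_smul_basis_det
    (Pi.basisFun ℝ (Fin k))
  have h1 := DFunLike.congr_fun h (fun i => A i)
  have e1 : (α.compLinearMap (Fintype.linearCombination ℝ f)) (Pi.basisFun ℝ (Fin k)) = α f := by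
    rw [AlternatingMap.compLinearMap_apply]
    congr 1
    funext i
    simp [Fintype.linearCombination_apply, Pi.single_apply]
  rw [e1, AlternatingMap.compLinearMap_apply, AlternatingMap.smul_apply, Pi.basisFun_det_apply,
    smul_eq_mul, mul_comm] at h1
  simp only [Fintype.linearCombination_apply] at h1
  exact h1

/-- The standard basis vectors of `ℝ^d`. -/
abbrev stdVec {d : ℕ} (i : Fin d) : EucA d := EuclideanSpace.single i 1

lemma inner_stdVec {d : ℕ} (i j : Fin d) :
    ⟪(stdVec i : EucA d), stdVec j⟫ = if i = j then 1 else 0 := by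
  simp [stdVec, EuclideanSpace.inner_single_left]

lemma orthonormal_stdVec (d : ℕ) : Orthonormal ℝ (stdVec : Fin d → EucA d) :=
  orthonormal_iff_ite.2 inner_stdVec

/-- A unit vector `x` together with an orthonormal family of vectors tangent to the sphere
at `x`. -/
structure SphereFrame {d : ℕ} {ι : Type*} (x : EucA d) (v : ι → EucA d) : Prop where
  unit : ⟪x, x⟫ = 1
  tangent : ∀ i, ⟪v i, x⟫ = 0
  orthonormal : Orthonormal ℝ v

namespace SphereFrame

variable {d : ℕ} {ι : Type*} {x : EucA d} {v : ι → EucA d}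

lemma norm_base (h : SphereFrame x v) : ‖x‖ = 1 := by
  have := h.unit
  rw [real_inner_self_eq_norm_sq] at this
  nlinarith [norm_nonneg x]

lemma mem_sphere (h : SphereFrame x v) : x ∈ usph d := by
  simpa [usph] using h.norm_base

lemma map (h : SphereFrame x v) {g : EucA d →L[ℝ] EucA d} (hg : g ∈ rotationSet d) :
    SphereFrame (g x) (fun i => g (v i)) where
  unit := by rw [rotationSet.inner_map hg, h.unit]
  tangent i := by rw [rotationSet.inner_map hg, h.tangent]
  orthonormal := by
    classical
    refine orthonormal_iff_ite.2 fun i j => ?_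
    rw [rotationSet.inner_map hg]
    exact orthonormal_iff_ite.1 h.orthonormal i j

lemma comp (h : SphereFrame x v) {κ : Type*} {f : κ → ι} (hf : Function.Injective f) :
    SphereFrame x (v ∘ f) where
  unit := h.unit
  tangent _ := h.tangent _
  orthonormal := h.orthonormal.comp f hf

lemma std (k : ℕ) : SphereFrame (stdVec (0 : Fin (k + 1))) (fun i : Fin k => stdVec i.succ) where
  unit := by simp
  tangent i := by simp [inner_stdVec]
  orthonormal := (orthonormal_stdVec (k + 1)).comp _ (Fin.succ_injective _)

lemma cons_orthonormal {k : ℕ} {v : Fin k → EucA d} (h : SphereFrame x v) :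
    Orthonormal ℝ (Fin.cons x v : Fin (k + 1) → EucA d) := by
  refine orthonormal_iff_ite.2 fun i j => ?_
  have hv := orthonormal_iff_ite.1 h.orthonormal
  refine Fin.cases ?_ (fun i => ?_) i <;> refine Fin.cases ?_ (fun j => ?_) j
  · simp [h.norm_base]
  · have := h.tangent j
    rw [real_inner_comm] at this
    simp [this, (Fin.succ_ne_zero _).symm]
  · simp [h.tangent]
  · simp [hv]

lemma expand {k : ℕ} {x : EucA (k + 1)} {v : Fin k → EucA (k + 1)} (h : SphereFrame x v)
    (w : EucA (k + 1)) : w = ⟪x, w⟫ • x + ∑ j, ⟪v j, w⟫ • v j := by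
  have hb := h.cons_orthonormal
  have hs : ⊤ ≤ Submodule.span ℝ (Set.range (Fin.cons x v : Fin (k + 1) → EucA (k + 1))) := by
    rw [hb.linearIndependent.span_eq_top_of_card_eq_finrank (by simp)]
  have := (OrthonormalBasis.mk hb hs).sum_repr' w
  rw [Fin.sum_univ_succ] at this
  simpa using this.symm

end SphereFrame

lemma SphereFrame.tproj_eq {k : ℕ} {x : EucA (k + 1)} {v : Fin k → EucA (k + 1)}
    (h : SphereFrame x v) (w : EucA (k + 1)) : tproj x w = ∑ j, ⟪v j, w⟫ • v j := by
  rw [tproj, real_inner_comm, sub_eq_iff_eq_add']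
  exact h.expand w

/-- The volume form of the sphere at `x`. -/
def sphVol {k : ℕ} (x : EucA (k + 1)) : (EucA (k + 1)) [⋀^Fin k]→ₗ[ℝ] ℝ :=
  ((Matrix.detRowAlternating (R := ℝ) (n := Fin (k + 1))).compLinearMap
    ((WithLp.linearEquiv 2 ℝ (Fin (k + 1) → ℝ)).toLinearMap)).curryLeft x

lemma sphVol_apply {k : ℕ} (x : EucA (k + 1)) (v : Fin k → EucA (k + 1)) :
    sphVol x v = (Matrix.of fun (i j : Fin (k + 1)) =>
          (Fin.cons x v : Fin (k + 1) → EucA (k + 1)) i j).det := rfl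

lemma sphVol_rotation {k : ℕ} {g : EucA (k + 1) →L[ℝ] EucA (k + 1)} (hg : g ∈ rotationSet (k + 1)) :
    sphVol (g (stdVec 0)) (fun i : Fin k => g (stdVec i.succ)) = 1 := by
  rw [sphVol_apply, ← hg.2, ContinuousLinearMap.det,
    ← LinearMap.det_toMatrix (EuclideanSpace.basisFun (Fin (k + 1)) ℝ).toBasis,
    ← Matrix.det_transpose]
  congr 1
  ext i j
  refine Fin.cases ?_ (fun j => ?_) j <;> simp [LinearMap.toMatrix_apply]

lemma sum_det_sq {k : ℕ} {x : EucA (k + 1)} {v : Fin k → EucA (k + 1)} (h : SphereFrame x v) :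
    ∑ σ : Fin k → Fin (k + 1),
      (Matrix.of fun i j : Fin k => v j (σ i)).det * (Matrix.of fun i j : Fin k => v j (σ i)).det
      = k.factorial := by
  have hv := orthonormal_iff_ite.1 h.orthonormal
  have e : ∀ π π' : Equiv.Perm (Fin k), ∑ σ : Fin k → Fin (k + 1),
      (((Equiv.Perm.sign π : ℤ) : ℝ) * ∏ i, v (π i) (σ i)) *
        (((Equiv.Perm.sign π' : ℤ) : ℝ) * ∏ i, v (π' i) (σ i)) = if π = π' then 1 else 0 := by
    intro π π'
    have e1 : ∏ i, ∑ s, v (π i) s * v (π' i) s = if π = π' then (1 : ℝ) else 0 := by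
      have e2 : ∀ i, ∑ s, v (π i) s * v (π' i) s = if π i = π' i then (1 : ℝ) else 0 := by
        intro i
        rw [← hv (π i) (π' i), PiLp.inner_apply]
        simp [mul_comm]
      simp only [e2, Finset.prod_ite_zero, Finset.prod_const_one, Finset.mem_univ, true_implies,
        Equiv.ext_iff]
    rw [Fintype.prod_sum] at e1
    have e3 : ∀ σ : Fin k → Fin (k + 1), (((Equiv.Perm.sign π : ℤ) : ℝ) * ∏ i, v (π i) (σ i)) *
        (((Equiv.Perm.sign π' : ℤ) : ℝ) * ∏ i, v (π' i) (σ i)) =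
        (((Equiv.Perm.sign π : ℤ) : ℝ) * ((Equiv.Perm.sign π' : ℤ) : ℝ)) *
          ∏ i, v (π i) (σ i) * v (π' i) (σ i) := by
      intro σ
      rw [Finset.prod_mul_distrib]
      ring
    simp only [e3]
    rw [← Finset.mul_sum, e1]
    split_ifs with hπ
    · rw [hπ, mul_one, ← Int.cast_mul, ← Units.val_mul, Int.units_mul_self]
      simp
    · simp
  have e0 : ∀ σ : Fin k → Fin (k + 1), (Matrix.of fun i j : Fin k => v j (σ i)).det =
      ∑ π : Equiv.Perm (Fin k), ((Equiv.Perm.sign π : ℤ) : ℝ) * ∏ i, v (π i) (σ i) := by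
    intro σ
    rw [← Matrix.det_transpose, Matrix.det_apply', ]
    rfl
  simp only [e0, Finset.sum_mul_sum]
  rw [Finset.sum_comm]
  simp only [Finset.sum_comm (s := (Finset.univ : Finset (Fin k → Fin (k + 1)))), e]
  simp [Fintype.card_perm]

lemma sphDensity_eq {k : ℕ} (α : (EucA (k + 1)) [⋀^Fin k]→ₗ[ℝ] ℝ)
    {g : EucA (k + 1) →L[ℝ] EucA (k + 1)} (hg : g ∈ rotationSet (k + 1)) :
    sphDensity rfl (fun v => α v) (g (stdVec 0)) = α fun i => g (stdVec i.succ) := by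
  have h := (SphereFrame.std k).map hg
  have h1 : ∀ (γ : (EucA (k + 1)) [⋀^Fin k]→ₗ[ℝ] ℝ) (σ : Fin k → Fin (k + 1)),
      γ (fun i => tproj (g (stdVec 0)) (EuclideanSpace.single (σ i) 1)) =
      (Matrix.of fun i j : Fin k => g (stdVec j.succ) (σ i)).det *
        γ fun i => g (stdVec i.succ) := by
    intro γ σ
    rw [← alternatingMap_matrix]
    congr 1
    funext i
    rw [h.tproj_eq]
    simp [EuclideanSpace.inner_single_right]
  have h2 : ∀ σ : Fin k → Fin (k + 1), (Matrix.of fun (i j : Fin (k + 1)) =>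
          (Fin.cons (g (stdVec 0)) fun i' : Fin k => tproj (g (stdVec 0))
            (EuclideanSpace.single (σ i') 1) :
            Fin (k + 1) → EucA (k + 1)) (Fin.cast rfl i) j).det =
        (Matrix.of fun i j : Fin k => g (stdVec j.succ) (σ i)).det := by
    intro σ
    have := h1 (sphVol (g (stdVec 0))) σ
    rw [sphVol_rotation hg, mul_one] at this
    exact this
  rw [sphDensity]
  simp only [h1, h2]
  have h3 := sum_det_sq h
  simp_rw [mul_right_comm _ (α _)]
  rw [← Finset.sum_mul, h3, ← mul_assoc, inv_mul_cancel₀, one_mul]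
  exact_mod_cast k.factorial_ne_zero

/-- The (unnormalised) antisymmetrised product of two alternating maps. -/
def wedgeAlt {E : Type*} [AddCommGroup E] [Module ℝ E] (p q : ℕ) (α : E [⋀^Fin p]→ₗ[ℝ] ℝ)
    (β : E [⋀^Fin q]→ₗ[ℝ] ℝ) : E [⋀^Fin (p + q)]→ₗ[ℝ] ℝ :=
  ((p.factorial * q.factorial : ℕ) : ℝ)⁻¹ • MultilinearMap.alternatization
    (((LinearMap.mul' ℝ ℝ).compMultilinearMap
      (MultilinearMap.domCoprod α.toMultilinearMap β.toMultilinearMap)).domDomCongr finSumFinEquiv)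

lemma wedgeAlt_apply {E : Type*} [AddCommGroup E] [Module ℝ E] (p q : ℕ) (α : E [⋀^Fin p]→ₗ[ℝ] ℝ)
    (β : E [⋀^Fin q]→ₗ[ℝ] ℝ) (v : Fin (p + q) → E) :
    wedgeAlt p q α β v = wedgeEval p q α β v := by
  rw [wedgeAlt, AlternatingMap.smul_apply, MultilinearMap.alternatization_apply, wedgeEval,
    smul_eq_mul]
  congr 1
  refine Finset.sum_congr rfl fun σ _ => ?_
  simp [MultilinearMap.domDomCongr_apply, Units.smul_def]

end

section

lemma exists_rotation_stdVec {k : ℕ} (hk : 1 ≤ k) {x : EucA (k + 1)} (hx : ⟪x, x⟫ = 1) :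
    ∃ g ∈ rotationSet (k + 1), g (stdVec 0) = x := by
  set v : EucA (k + 1) := stdVec 0 with hv
  have hvv : ⟪v, v⟫ = 1 := by simp [hv]
  set c := ⟪v, x⟫ with hc
  set r := x - c • v with hr
  have hvr : ⟪v, r⟫ = 0 := by
    simp only [hr, inner_sub_right, real_inner_smul_right, hvv, ← hc]
    ring
  have hxr : x = c • v + r := by rw [hr]; module
  have hrr : ⟪r, r⟫ = 1 - c ^ 2 := by
    have : ⟪x, v⟫ = c := real_inner_comm _ _
    simp only [hr, inner_sub_left, inner_sub_right, real_inner_smul_left, real_inner_smul_right,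
      hx, hvv, this, ← hc]
    ring
  have hn2 : ‖r‖ ^ 2 = 1 - c ^ 2 := by rw [← real_inner_self_eq_norm_sq, hrr]
  have hc1 : c ^ 2 ≤ 1 := by nlinarith [sq_nonneg ‖r‖]
  have hcl : -1 ≤ c := by nlinarith
  have hcu : c ≤ 1 := by nlinarith
  have hsin : Real.sin (Real.arccos c) = ‖r‖ := by
    rw [Real.sin_arccos, ← hn2, Real.sqrt_sq (norm_nonneg _)]
  have hcos : Real.cos (Real.arccos c) = c := Real.cos_arccos hcl hcu
  obtain ⟨w, hw, hrw⟩ : ∃ w, OrthoPair v w ∧ r = ‖r‖ • w := by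
    by_cases h0 : r = 0
    · refine ⟨stdVec ⟨1, by omega⟩, ⟨hvv, by simp, ?_⟩, by simp [h0]⟩
      rw [hv, inner_stdVec, if_neg]
      simp [Fin.ext_iff]
    · have hn : ‖r‖ ≠ 0 := norm_ne_zero_iff.2 h0
      refine ⟨‖r‖⁻¹ • r, ⟨hvv, ?_, ?_⟩, ?_⟩
      · rw [real_inner_smul_left, real_inner_smul_right, real_inner_self_eq_norm_sq]
        field_simp
      · rw [real_inner_smul_right, hvr, mul_zero]
      · rw [smul_smul, mul_inv_cancel₀ hn, one_smul]
  refine ⟨planeRot v w (Real.arccos c), hw.rot_mem _, ?_⟩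
  rw [hw.rot_left, hcos, hsin, ← hrw, ← hxr]

open Metric in
lemma hausdorffMeasure_usph_lt_top (k : ℕ) : μH[(k : ℝ)] (usph (k + 1)) < ⊤ := by
  have key : ∀ v : EucA (k + 1), ‖v‖ = 1 →
      μH[(k : ℝ)] {x | x ∈ usph (k + 1) ∧ ⟪v, x⟫ ≤ 0} < ⊤ := by
    intro v hv
    have hv0 : v ≠ 0 := by rintro rfl; simp at hv
    have hrank : Module.finrank ℝ (ℝ ∙ v)ᗮ = k :=
      have : Fact (Module.finrank ℝ (EucA (k + 1)) = k + 1) := ⟨by simp⟩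
      Submodule.finrank_orthogonal_span_singleton hv0
    let f : (ℝ ∙ v)ᗮ → EucA (k + 1) := fun y => stereoInvFunAux v (y : EucA (k + 1))
    have hf : ContDiff ℝ 1 f := contDiff_stereoInvFunAux.comp (ℝ ∙ v)ᗮ.subtypeL.contDiff
    obtain ⟨K, hK⟩ := (hf.locallyLipschitz.locallyLipschitzOn
      (s := closedBall 0 2)).exists_lipschitzOnWith_of_compact (isCompact_closedBall _ _)
    have hfin : μH[(k : ℝ)] (closedBall (0 : (ℝ ∙ v)ᗮ) 2) < ⊤ := by
      have := isAddHaarMeasure_hausdorffMeasure (E := (ℝ ∙ v)ᗮ)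
      rw [hrank] at this
      exact (isCompact_closedBall _ _).measure_lt_top
    have h1 := hK.hausdorffMeasure_image_le (d := (k : ℝ)) (Nat.cast_nonneg k)
    refine (measure_mono ?_).trans_lt (h1.trans_lt
      (ENNReal.mul_lt_top (ENNReal.rpow_lt_top_of_nonneg (Nat.cast_nonneg k) ENNReal.coe_ne_top)
        hfin))
    rintro x ⟨hx, hvx⟩
    have hxv : (x : EucA (k + 1)) ≠ v := by
      rintro rfl
      rw [real_inner_self_eq_norm_sq, hv] at hvx
      norm_num at hvx
    refine ⟨stereoToFun v x, ?_, ?_⟩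
    · rw [mem_closedBall_zero_iff, stereoToFun_apply, norm_smul]
      have h2 : ‖(ℝ ∙ v)ᗮ.orthogonalProjectionOnto x‖ ≤ 1 := by
        refine ((ℝ ∙ v)ᗮ.norm_orthogonalProjectionOnto_apply_le x).trans ?_
        simpa [usph] using (mem_sphere_zero_iff_norm.1 hx).le
      have h3 : ‖2 / (1 - innerSL ℝ v x)‖ ≤ 2 := by
        rw [innerSL_apply_apply, Real.norm_eq_abs, abs_of_nonneg (by apply div_nonneg <;> linarith)]
        rw [div_le_iff₀ (by linarith)]
        linarith
      calc _ ≤ 2 * (1 : ℝ) := by gcongr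
        _ = 2 := by norm_num
    · exact congrArg Subtype.val (stereo_left_inv hv (x := ⟨x, hx⟩) hxv)
  have h0 : ‖(stdVec 0 : EucA (k + 1))‖ = 1 := by simp
  refine (measure_mono ?_).trans_lt ((measure_union_le _ _).trans_lt
    (ENNReal.add_lt_top.2 ⟨key (stdVec 0) h0, key (-stdVec 0) (by rw [norm_neg, h0])⟩))
  intro x hx
  rcases le_total ⟪(stdVec 0 : EucA (k + 1)), x⟫ 0 with h | h
  · exact Or.inl ⟨hx, h⟩
  · refine Or.inr ⟨hx, ?_⟩
    rw [inner_neg_left]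
    linarith

/-- The surface measure of the unit sphere. -/
def sphMeas (k : ℕ) : Measure (EucA (k + 1)) := μH[(k : ℝ)].restrict (usph (k + 1))

instance (k : ℕ) : IsFiniteMeasure (sphMeas k) :=
  ⟨by rw [sphMeas, Measure.restrict_apply_univ]; exact hausdorffMeasure_usph_lt_top k⟩

lemma isCompact_usph (d : ℕ) : IsCompact (usph d) := isCompact_sphere _ _

lemma sphMeas_restrict (k : ℕ) : (sphMeas k).restrict (usph (k + 1)) = sphMeas k := by
  rw [sphMeas, Measure.restrict_restrict (isCompact_usph _).measurableSet, inter_self]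

lemma integrable_prod_of_isCompact {X Y : Type*} [TopologicalSpace X] [TopologicalSpace Y]
    [T2Space X] [T2Space Y]
    [MeasurableSpace X] [MeasurableSpace Y] [OpensMeasurableSpace X] [OpensMeasurableSpace Y]
    [SecondCountableTopology X] [SecondCountableTopology Y]
    {μ : Measure X} {ν : Measure Y} [IsFiniteMeasure μ] [IsFiniteMeasure ν] {K : Set X} {L : Set Y}
    (hK : IsCompact K) (hL : IsCompact L) (hμ : μ.restrict K = μ) (hν : ν.restrict L = ν)
    {F : Type*} [NormedAddCommGroup F]
    {f : X × Y → F} (hf : Continuous f) : Integrable f (μ.prod ν) := by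
  rw [← hμ, ← hν, Measure.prod_restrict]
  exact hf.continuousOn.integrableOn_compact' (hK.prod hL)
    (hK.measurableSet.prod hL.measurableSet)

lemma sphMeas_integral_comp {k : ℕ} {g : EucA (k + 1) →L[ℝ] EucA (k + 1)}
    (hg : g ∈ rotationSet (k + 1)) (f : EucA (k + 1) → ℝ) :
    ∫ x, f (g x) ∂sphMeas k = ∫ x, f x ∂sphMeas k := by
  let e : EucA (k + 1) ≃ₗᵢ[ℝ] EucA (k + 1) :=
    Unitary.linearIsometryEquiv ⟨g, rotationSet.mem_unitary hg⟩
  have he : ∀ x, e x = g x := fun x => rfl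
  have hp := e.toIsometryEquiv.measurePreserving_hausdorffMeasure (k : ℝ)
  have h1 := hp.setIntegral_preimage_emb e.toHomeomorph.measurableEmbedding f (usph (k + 1))
  have h2 : (e.toIsometryEquiv : EucA (k + 1) → EucA (k + 1)) ⁻¹' usph (k + 1) = usph (k + 1) := by
    ext x
    simp [usph]
  rw [h2] at h1
  exact h1

theorem sphMeas_integral {k : ℕ} (hk : 1 ≤ k) {f : EucA (k + 1) → ℝ} (hf : Continuous f) :
    ∫ x, f x ∂sphMeas k =
      (sphMeas k).real univ * ∫ g, f (g (stdVec 0)) ∂rotMeasure (k + 1) := by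
  have h1 : ∫ g, ∫ x, f (g x) ∂sphMeas k ∂rotMeasure (k + 1) = ∫ x, f x ∂sphMeas k := by
    rw [integral_congr_ae (g := fun _ => ∫ x, f x ∂sphMeas k)
      ((rotMeasure_ae (k + 1)).mono fun g hg => sphMeas_integral_comp hg f)]
    simp
  rw [← h1, integral_integral_swap]
  · have h2 : ∀ᵐ x ∂sphMeas k, ∫ g, f (g x) ∂rotMeasure (k + 1) =
        ∫ g, f (g (stdVec 0)) ∂rotMeasure (k + 1) := by
      rw [sphMeas]
      refine (ae_restrict_mem (isCompact_usph _).measurableSet).mono fun x hx => ?_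
      obtain ⟨h, hh, rfl⟩ := exists_rotation_stdVec hk (x := x) (by
        rw [real_inner_self_eq_norm_sq, mem_sphere_zero_iff_norm.1 hx, one_pow])
      exact integral_comp_right hh (f := fun g => f (g (stdVec 0))) (by fun_prop)
    rw [integral_congr_ae h2]
    simp
  · refine integrable_prod_of_isCompact rotationSet.isCompact (isCompact_usph _)
      (rotMeasure_restrict _) (sphMeas_restrict _) ?_
    change Continuous fun p : (EucA (k + 1) →L[ℝ] EucA (k + 1)) × EucA (k + 1) => f (p.1 p.2)
    fun_prop

theorem sphereFormIntegral_eq {k : ℕ} (hk : 1 ≤ k)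
    (α : EucA (k + 1) → (EucA (k + 1)) [⋀^Fin k]→ₗ[ℝ] ℝ)
    (hα : ∀ u : Fin k → EucA (k + 1) → EucA (k + 1), (∀ i, Continuous (u i)) →
      Continuous fun x => α x fun i => u i x) :
    sphereFormIntegral rfl (k : ℝ) (fun x v => α x v) = (sphMeas k).real univ *
      ∫ g, α (g (stdVec 0)) (fun i => g (stdVec i.succ)) ∂rotMeasure (k + 1) := by
  have hc : Continuous fun x => sphDensity rfl (fun v => α x v) x := by
    unfold sphDensity
    have ht : ∀ i : Fin (k + 1), Continuous fun x : EucA (k + 1) =>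
        tproj x (EuclideanSpace.single i 1) := by
      intro i
      unfold tproj
      fun_prop
    refine continuous_const.mul (continuous_finsetSum _ fun σ _ => ?_)
    refine (hα (fun i x => tproj x (EuclideanSpace.single (σ i) 1)) fun i => ht _).mul ?_
    refine Continuous.matrix_det (continuous_matrix fun i j => ?_)
    simp only [Matrix.of_apply, Fin.cast_eq_self]
    have h1 : Continuous fun x : EucA (k + 1) => (Fin.cons x fun i' : Fin k =>
        tproj x (EuclideanSpace.single (σ i') 1) : Fin (k + 1) → EucA (k + 1)) i := by
      refine Fin.cases ?_ (fun i => ?_) i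
      · simpa using continuous_id'
      · simpa using ht (σ i)
    exact (EuclideanSpace.proj (𝕜 := ℝ) j).continuous.comp h1
  rw [sphereFormIntegral]
  refine (sphMeas_integral hk hc).trans ?_
  congr 1
  exact integral_congr_ae ((rotMeasure_ae (k + 1)).mono fun g hg => sphDensity_eq _ hg)

end

section

variable {d : ℕ}

lemma integral_sub_eq_intervalIntegral {f f' : ℝ → (EucA d →L[ℝ] EucA d) → ℝ}
    (hd : ∀ g t, HasDerivAt (fun t => f t g) (f' t g) t) (hf : ∀ t, Continuous (f t))
    (hf' : Continuous fun p : ℝ × (EucA d →L[ℝ] EucA d) => f' p.1 p.2) {a b : ℝ} (hab : a ≤ b) :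
    ∫ g, f b g ∂rotMeasure d - ∫ g, f a g ∂rotMeasure d =
      ∫ t in a..b, ∫ g, f' t g ∂rotMeasure d := by
  have h1 : ∀ g, ∫ t in a..b, f' t g = f b g - f a g := fun g =>
    intervalIntegral.integral_eq_sub_of_hasDerivAt (fun t _ => hd g t)
      ((by fun_prop : Continuous fun t => f' t g).intervalIntegrable _ _)
  rw [← integral_sub (integrable_rot (hf b)) (integrable_rot (hf a))]
  simp_rw [← h1, intervalIntegral.integral_of_le hab, ← integral_Icc_eq_integral_Ioc]
  rw [integral_integral_swap]
  refine integrable_prod_of_isCompact rotationSet.isCompact isCompact_Icc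
    (rotMeasure_restrict d) (by rw [Measure.restrict_restrict measurableSet_Icc, inter_self]) ?_
  exact hf'.comp continuous_swap

lemma continuous_planeRot (u w : EucA d) : Continuous (planeRot u w) := by
  unfold planeRot
  fun_prop

lemma integral_eq_zero_of_hasDerivAt {u w : EucA d} (h : OrthoPair u w)
    {f L : (EucA d →L[ℝ] EucA d) → ℝ} (hf : Continuous f) (hL : Continuous L)
    (hd : ∀ g t, HasDerivAt (fun t => f (g ∘L planeRot u w t)) (L (g ∘L planeRot u w t)) t) :
    ∫ g, L g ∂rotMeasure d = 0 := by
  have h1 := integral_sub_eq_intervalIntegral (f := fun t g => f (g ∘L planeRot u w t))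
    (f' := fun t g => L (g ∘L planeRot u w t)) hd (fun t => by fun_prop)
    (hL.comp (continuous_snd.clm_comp ((continuous_planeRot u w).comp continuous_fst)))
    (zero_le_one' ℝ)
  simp only [integral_comp_right (h.rot_mem _) hf, integral_comp_right (h.rot_mem _) hL] at h1
  simpa using h1.symm

lemma SphereFrame.orthoPair {ι : Type*} {x : EucA d} {v : ι → EucA d} (h : SphereFrame x v)
    {i j : ι} (hij : i ≠ j) : OrthoPair (v i) (v j) := by
  classical
  have hv := orthonormal_iff_ite.1 h.orthonormal
  exact ⟨by have := hv i i; rwa [if_pos rfl] at this,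
    by have := hv j j; rwa [if_pos rfl] at this, by simp [hv, hij]⟩

lemma SphereFrame.orthoPair_base {ι : Type*} {x : EucA d} {v : ι → EucA d} (h : SphereFrame x v)
    (i : ι) : OrthoPair x (v i) := by
  classical
  have hv := orthonormal_iff_ite.1 h.orthonormal
  exact ⟨h.unit, by have := hv i i; rwa [if_pos rfl] at this, by rw [real_inner_comm, h.tangent]⟩

lemma integral_perm_frame {ι : Type*} [Fintype ι] [DecidableEq ι]
    {Q : EucA d → (ι → EucA d) → ℝ}
    (hQ : ∀ (x : EucA d) (v : ι → EucA d),
      Continuous fun g : EucA d →L[ℝ] EucA d => Q (g x) fun i => g (v i))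
    (hneg : ∀ (x : EucA d) (v : ι → EucA d) (j : ι), Q x (Function.update v j (-(v j))) = -Q x v)
    {x : EucA d} {v : ι → EucA d} (h : SphereFrame x v) (π : Equiv.Perm ι) :
    ∫ g, Q (g x) (fun i => g (v (π i))) ∂rotMeasure d =
      ((Equiv.Perm.sign π : ℤ) : ℝ) * ∫ g, Q (g x) (fun i => g (v i)) ∂rotMeasure d := by
  induction π using Equiv.Perm.swap_induction_on generalizing v with
  | one => simp
  | swap_mul π i j hij ih =>
    have h1 := ih (h.comp (Equiv.swap i j).injective)
    simp only [Function.comp_apply] at h1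
    simp only [Equiv.Perm.mul_apply, h1, Equiv.Perm.sign_mul, Equiv.Perm.sign_swap hij]
    have hp := h.orthoPair hij
    have h2 := integral_comp_right (hp.rot_mem (Real.pi / 2)) (hQ x v)
    have h3 : ∀ g : EucA d →L[ℝ] EucA d, Q ((g ∘L planeRot (v i) (v j) (Real.pi / 2)) x)
        (fun k => (g ∘L planeRot (v i) (v j) (Real.pi / 2)) (v k)) =
        -Q (g x) fun k => g (v (Equiv.swap i j k)) := by
      intro g
      rw [← hneg _ _ j]
      congr 1
      · rw [ContinuousLinearMap.comp_apply, OrthoPair.rot_of_ortho (h.tangent i) (h.tangent j)]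
      · funext k
        rw [ContinuousLinearMap.comp_apply]
        by_cases hkj : k = j
        · subst hkj
          simp [hp.rot_right]
        · rw [Function.update_of_ne hkj]
          by_cases hki : k = i
          · subst hki
            simp [hp.rot_left]
          · have hv := orthonormal_iff_ite.1 h.orthonormal
            rw [Equiv.swap_apply_of_ne_of_ne hki hkj, OrthoPair.rot_of_ortho]
            · simp [hv, Ne.symm hki]
            · simp [hv, Ne.symm hkj]
    simp only [h3, integral_neg] at h2
    rw [← h2]
    simp

variable {p q : ℕ}

/-- The integral over all rotations `g` of `α ⊗ β` evaluated on the frame moved by `g`. -/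
def pairing (x : EucA d) (a : Fin p → EucA d) (b : Fin q → EucA d)
    (α : EucA d → EucA d [⋀^Fin p]→L[ℝ] ℝ) (β : EucA d → EucA d [⋀^Fin q]→L[ℝ] ℝ) : ℝ :=
  ∫ g, α (g x) (fun i => g (a i)) * β (g x) (fun j => g (b j)) ∂rotMeasure d

lemma pairing_comm (x : EucA d) (a : Fin p → EucA d) (b : Fin q → EucA d)
    (α : EucA d → EucA d [⋀^Fin p]→L[ℝ] ℝ) (β : EucA d → EucA d [⋀^Fin q]→L[ℝ] ℝ) :
    pairing x a b α β = pairing x b a β α := by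
  simp only [pairing, mul_comm]

lemma update_neg_alternating {ι : Type*} [DecidableEq ι] (α : EucA d [⋀^ι]→L[ℝ] ℝ)
    (v : ι → EucA d) (j : ι) : α (Function.update v j (-(v j))) = -α v := by
  have := α.toAlternatingMap.map_update_neg v j (v j)
  rw [Function.update_eq_self] at this
  exact this

lemma pairing_extDeriv_left {θ : EucA d → EucA d [⋀^Fin p]→L[ℝ] ℝ}
    {φ : EucA d → EucA d [⋀^Fin q]→L[ℝ] ℝ} (hθ : ContDiff ℝ 1 θ) (hφ : Continuous φ)
    {x : EucA d} {v : Fin (p + 1) → EucA d} {b : Fin q → EucA d}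
    (h : SphereFrame x (Sum.elim v b)) :
    pairing x v b (extDeriv θ) φ = (p + 1) * ∫ g, fderiv ℝ θ (g x) (g (v 0))
      (fun i => g (v i.succ)) * φ (g x) (fun j => g (b j)) ∂rotMeasure d := by
  have hθ' : Continuous (fderiv ℝ θ) := hθ.continuous_fderiv one_ne_zero
  let Q : EucA d → (Fin (p + 1) ⊕ Fin q → EucA d) → ℝ := fun x w =>
    fderiv ℝ θ x (w (Sum.inl 0)) (fun i => w (Sum.inl i.succ)) * φ x fun j => w (Sum.inr j)
  have hQ : ∀ (x : EucA d) (v : Fin (p + 1) ⊕ Fin q → EucA d),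
      Continuous fun g : EucA d →L[ℝ] EucA d => Q (g x) fun i => g (v i) := by
    intro x v
    have : Continuous fun g : EucA d →L[ℝ] EucA d => fderiv ℝ θ (g x) (g (v (Sum.inl 0))) :=
      (hθ'.comp (by fun_prop)).clm_apply (by fun_prop)
    simp only [Q]
    fun_prop
  have hneg : ∀ (x : EucA d) (v : Fin (p + 1) ⊕ Fin q → EucA d) (j : Fin (p + 1) ⊕ Fin q),
      Q x (Function.update v j (-(v j))) = -Q x v := by
    intro x v j
    rcases j with j | j
    · refine Fin.cases ?_ (fun j => ?_) j
      · simp [Q]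
      · have e : (fun i : Fin p => Function.update v (Sum.inl j.succ) (-(v (Sum.inl j.succ)))
            (Sum.inl i.succ)) = Function.update (fun i : Fin p => v (Sum.inl i.succ)) j
              (-(v (Sum.inl j.succ))) := by
          funext i
          simp [Function.update_apply]
        simp only [Q, e]
        rw [update_neg_alternating _ (fun i : Fin p => v (Sum.inl i.succ)) j]
        simp [(Fin.succ_ne_zero j).symm]
    · have e : (fun i : Fin q => Function.update v (Sum.inr j) (-(v (Sum.inr j)))
            (Sum.inr i)) = Function.update (fun i : Fin q => v (Sum.inr i)) j
              (-(v (Sum.inr j))) := by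
          funext i
          simp [Function.update_apply]
      simp only [Q, e]
      rw [update_neg_alternating _ (fun i : Fin q => v (Sum.inr i)) j]
      simp
  have hint : ∀ i : Fin (p + 1), ∫ g, (-1 : ℝ) ^ (i : ℕ) * (fderiv ℝ θ (g x) (g (v i))
      (fun j => g (v (i.succAbove j))) * φ (g x) fun j => g (b j)) ∂rotMeasure d =
      ∫ g, Q (g x) (fun j => g (Sum.elim v b j)) ∂rotMeasure d := by
    intro i
    have h1 := integral_perm_frame hQ hneg h (Equiv.Perm.sumCongr i.cycleRange.symm 1)
    rw [Equiv.Perm.sign_sumCongr, Equiv.Perm.sign_symm, Fin.sign_cycleRange] at h1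
    simp only [Q, Equiv.Perm.sumCongr_apply, Sum.map_inl, Sum.map_inr, Sum.elim_inl, Sum.elim_inr,
      Fin.cycleRange_symm_zero, Fin.cycleRange_symm_succ, Equiv.Perm.sign_one, mul_one,
      Equiv.Perm.one_apply] at h1 ⊢
    rw [integral_const_mul, h1, ← mul_assoc]
    push_cast
    rw [← mul_pow]
    simp
  have hexp : ∀ g : EucA d →L[ℝ] EucA d, extDeriv θ (g x) (fun i => g (v i)) *
      φ (g x) (fun j => g (b j)) = ∑ i : Fin (p + 1), (-1 : ℝ) ^ (i : ℕ) *
        (fderiv ℝ θ (g x) (g (v i)) (fun j => g (v (i.succAbove j))) *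
          φ (g x) fun j => g (b j)) := by
    intro g
    rw [extDeriv, ContinuousAlternatingMap.alternatizeUncurryFin_apply, Finset.sum_mul]
    refine Finset.sum_congr rfl fun i _ => ?_
    simp only [Int.reduceNeg, zsmul_eq_mul, Int.cast_pow, Int.cast_neg, Int.cast_one, mul_assoc]
    rfl
  rw [pairing]
  simp only [hexp]
  rw [integral_finsetSum]
  · simp only [hint]
    simp [Q]
  · intro i _
    refine integrable_rot ?_
    have : Continuous fun g : EucA d →L[ℝ] EucA d => fderiv ℝ θ (g x) (g (v i)) :=
      (hθ'.comp (by fun_prop)).clm_apply (by fun_prop)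
    fun_prop

theorem pairing_extDeriv {θ : EucA d → EucA d [⋀^Fin p]→L[ℝ] ℝ}
    {φ : EucA d → EucA d [⋀^Fin q]→L[ℝ] ℝ} (hθ : ContDiff ℝ 1 θ) (hφ : ContDiff ℝ 1 φ)
    {x : EucA d} {v : Fin (p + 1) → EucA d} {b : Fin q → EucA d}
    (h : SphereFrame x (Sum.elim v b)) :
    (q + 1) * pairing x v b (extDeriv θ) φ = -((p + 1) * pairing x (fun i => v i.succ)
      (Fin.cons (v 0) b : Fin (q + 1) → EucA d) θ (extDeriv φ)) := by
  have h' : SphereFrame x (Sum.elim (Fin.cons (v 0) b : Fin (q + 1) → EucA d)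
      fun i : Fin p => v i.succ) := by
    let s : Fin (q + 1) ⊕ Fin p → Fin (p + 1) ⊕ Fin q :=
      Sum.elim (Fin.cons (Sum.inl 0) fun j => Sum.inr j) fun i => Sum.inl i.succ
    have hs : Function.Injective s := by
      rintro (i | i) (j | j)
      · refine Fin.cases ?_ (fun i => ?_) i <;> refine Fin.cases ?_ (fun j => ?_) j <;> simp [s]
      · refine Fin.cases ?_ (fun i => ?_) i <;> simp [s, (Fin.succ_ne_zero _).symm]
      · refine Fin.cases ?_ (fun i => ?_) j <;> simp [s]
      · simp [s]
    have := h.comp hs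
    convert this using 1
    funext i
    rcases i with i | i
    · refine Fin.cases ?_ (fun i => ?_) i <;> simp [s]
    · simp [s]
  rw [pairing_comm x (fun i => v i.succ), pairing_extDeriv_left hθ hφ.continuous h,
    pairing_extDeriv_left hφ hθ.continuous h']
  have hθ' : Continuous (fderiv ℝ θ) := hθ.continuous_fderiv one_ne_zero
  have hφ' : Continuous (fderiv ℝ φ) := hφ.continuous_fderiv one_ne_zero
  have hcθ := hθ.continuous
  have hcφ := hφ.continuous
  have c1 : Continuous fun g : EucA d →L[ℝ] EucA d => fderiv ℝ θ (g x) (g (v 0)) :=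
    (hθ'.comp (by fun_prop)).clm_apply (by fun_prop)
  have c2 : Continuous fun g : EucA d →L[ℝ] EucA d => fderiv ℝ φ (g x) (g (v 0)) :=
    (hφ'.comp (by fun_prop)).clm_apply (by fun_prop)
  have hp := h.orthoPair_base (Sum.inl 0)
  simp only [Sum.elim_inl] at hp
  have key := integral_eq_zero_of_hasDerivAt hp
    (f := fun g => θ (g x) (fun i => g (v i.succ)) * φ (g x) fun j => g (b j))
    (L := fun g => fderiv ℝ θ (g x) (g (v 0)) (fun i => g (v i.succ)) *
      φ (g x) (fun j => g (b j)) + fderiv ℝ φ (g x) (g (v 0)) (fun j => g (b j)) *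
        θ (g x) (fun i => g (v i.succ))) (by fun_prop) (by fun_prop) (by
    intro g t
    have e1 : ∀ (t : ℝ) (i : Fin p), planeRot x (v 0) t (v i.succ) = v i.succ := fun t i =>
      OrthoPair.rot_of_ortho (by rw [real_inner_comm]; exact h.tangent (Sum.inl i.succ))
        ((h.orthoPair (i := Sum.inl 0) (j := Sum.inl i.succ)
          (by simp [(Fin.succ_ne_zero _).symm])).ortho) t
    have e2 : ∀ (t : ℝ) (j : Fin q), planeRot x (v 0) t (b j) = b j := fun t i =>
      OrthoPair.rot_of_ortho (by rw [real_inner_comm]; exact h.tangent (Sum.inr i))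
        ((h.orthoPair (i := Sum.inl 0) (j := Sum.inr i) (by simp)).ortho) t
    simp only [ContinuousLinearMap.comp_apply, e1, e2]
    have hγ : HasDerivAt (fun t => g (planeRot x (v 0) t x)) (g (planeRot x (v 0) t (v 0))) t := by
      have h1 := (hp.hasDerivAt_rot t).clm_apply (hasDerivAt_const t x)
      have h2 := g.hasFDerivAt.comp_hasDerivAt t h1
      have e3 : (planeRot x (v 0) t ∘L planeGen x (v 0)) x + planeRot x (v 0) t 0 =
          planeRot x (v 0) t (v 0) := by
        rw [ContinuousLinearMap.comp_apply, planeGen_apply, hp.left, hp.ortho', map_zero, one_smul,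
          zero_smul, sub_zero, add_zero]
      rw [e3] at h2
      exact h2
    have hT : HasDerivAt (fun t => θ (g (planeRot x (v 0) t x)) fun i => g (v i.succ))
        (fderiv ℝ θ (g (planeRot x (v 0) t x)) (g (planeRot x (v 0) t (v 0)))
          fun i => g (v i.succ)) t :=
      ((hθ.differentiable one_ne_zero _).hasFDerivAt.continuousAlternatingMap_apply_const
        (fun i => g (v i.succ))).comp_hasDerivAt t hγ
    have hP : HasDerivAt (fun t => φ (g (planeRot x (v 0) t x)) fun i => g (b i))
        (fderiv ℝ φ (g (planeRot x (v 0) t x)) (g (planeRot x (v 0) t (v 0)))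
          fun i => g (b i)) t :=
      ((hφ.differentiable one_ne_zero _).hasFDerivAt.continuousAlternatingMap_apply_const
        (fun i => g (b i))).comp_hasDerivAt t hγ
    exact (hT.mul hP).congr_deriv (by ring))
  rw [integral_add (integrable_rot (by fun_prop)) (integrable_rot (by fun_prop))] at key
  simp only [Fin.cons_zero, Fin.cons_succ]
  linear_combination (q + 1) * (p + 1) * key

end

section

variable {d : ℕ} {p q : ℕ}

lemma two_le_smooth : (2 : WithTop ℕ∞) ≤ ((⊤ : ℕ∞) : WithTop ℕ∞) :=
  WithTop.coe_le_coe.2 (le_top : (2 : ℕ∞) ≤ ⊤)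

lemma AlternatingMap.apply_eq_sum_stdVec (α : (EucA d) [⋀^Fin p]→ₗ[ℝ] ℝ) (v : Fin p → EucA d) :
    α v = ∑ σ : Fin p → Fin d, (∏ i, v i (σ i)) * α fun i => stdVec (σ i) := by
  have hv : v = fun i => ∑ j, v i j • (stdVec j : EucA d) := by
    funext i
    ext k
    simp [stdVec, Pi.single_apply]
  conv_lhs => rw [hv]
  rw [← AlternatingMap.coe_multilinearMap, MultilinearMap.map_sum]
  refine Finset.sum_congr rfl fun σ _ => ?_
  rw [MultilinearMap.map_smul_univ, smul_eq_mul]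

lemma AlternatingMap.continuous_euclidean (α : (EucA d) [⋀^Fin p]→ₗ[ℝ] ℝ) :
    Continuous α := by
  have : (α : (Fin p → EucA d) → ℝ) = fun v => ∑ σ : Fin p → Fin d, (∏ i, v i (σ i)) *
    α fun i => stdVec (σ i) := funext α.apply_eq_sum_stdVec
  rw [this]
  fun_prop

/-- An alternating map on Euclidean space as a continuous alternating map. -/
def AlternatingMap.toEuclideanCLM (α : (EucA d) [⋀^Fin p]→ₗ[ℝ] ℝ) : EucA d [⋀^Fin p]→L[ℝ] ℝ :=
  { α with cont := α.continuous_euclidean }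

section ContDiff

variable {X : Type*} [NormedAddCommGroup X] [NormedSpace ℝ X] {n : WithTop ℕ∞}

/-- Smoothness of a family of forms can be checked on constant vectors. -/
lemma contDiff_of_apply {α : X → EucA d [⋀^Fin p]→L[ℝ] ℝ}
    (h : ∀ v, ContDiff ℝ n fun y => α y v) : ContDiff ℝ n α := by
  let ev : (EucA d [⋀^Fin p]→L[ℝ] ℝ) →ₗ[ℝ] ((Fin p → Fin d) → ℝ) :=
    { toFun := fun β σ => β fun i => stdVec (σ i)
      map_add' := fun _ _ => rfl
      map_smul' := fun _ _ => rfl }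
  have hev : LinearMap.ker ev = ⊥ := by
    rw [LinearMap.ker_eq_bot]
    intro β γ hβγ
    ext v
    have e1 := β.toAlternatingMap.apply_eq_sum_stdVec v
    have e2 := γ.toAlternatingMap.apply_eq_sum_stdVec v
    refine e1.trans (Eq.trans ?_ e2.symm)
    exact Finset.sum_congr rfl fun σ _ => congrArg _ (congrFun hβγ σ)
  obtain ⟨L, hL⟩ := ev.exists_leftInverse_of_injective hev
  have : α = fun y => L.toContinuousLinearMap (ev (α y)) := by
    funext y
    exact (LinearMap.congr_fun hL (α y)).symm
  rw [this]
  refine L.toContinuousLinearMap.contDiff.comp ?_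
  rw [contDiff_pi]
  exact fun σ => h _

lemma ContDiff.form_apply {α : X → EucA d [⋀^Fin p]→L[ℝ] ℝ} (hα : ContDiff ℝ n α)
    {v : Fin p → X → EucA d} (hv : ∀ i, ContDiff ℝ n (v i)) :
    ContDiff ℝ n fun y => α y fun i => v i y := by
  have e : (fun y => α y fun i => v i y) = fun y => ∑ σ : Fin p → Fin d,
      (∏ i, v i y (σ i)) * α y fun i => stdVec (σ i) :=
    funext fun y => (α y).toAlternatingMap.apply_eq_sum_stdVec fun i => v i y
  rw [e]
  refine ContDiff.sum fun σ _ => ContDiff.mul (contDiff_prod fun i _ => ?_) ?_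
  · exact contDiff_euclidean.1 (hv i) (σ i)
  · exact (ContinuousAlternatingMap.apply ℝ (EucA d) ℝ (fun i => stdVec (σ i))).contDiff.comp hα

end ContDiff

lemma exists_contDiff_form {α : EucA d → (EucA d) [⋀^Fin p]→ₗ[ℝ] ℝ} {n : WithTop ℕ∞}
    (hα : ∀ v, ContDiff ℝ n fun y => α y v) :
    ContDiff ℝ n fun y => (α y).toEuclideanCLM :=
  contDiff_of_apply hα

lemma extDEval_eq_extDeriv {α : EucA d → (EucA d) [⋀^Fin p]→ₗ[ℝ] ℝ}
    (hα : ∀ v, ContDiff ℝ (⊤ : ℕ∞) fun y => α y v) (x : EucA d) (v : Fin (p + 1) → EucA d) :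
    extDEval α x v = extDeriv (fun y => (α y).toEuclideanCLM) x v := by
  rw [extDeriv_apply ((exists_contDiff_form hα).differentiable (by simp) x), extDEval]
  refine Finset.sum_congr rfl fun i _ => ?_
  rw [zsmul_eq_mul]
  push_cast
  rfl

/-- The pullback of a form on Euclidean space. -/
def pullbackForm {e : ℕ} (F : EucA d → EucA e) (ω : EucA e → EucA e [⋀^Fin p]→L[ℝ] ℝ) (x : EucA d) :
    EucA d [⋀^Fin p]→L[ℝ] ℝ := (ω (F x)).compContinuousLinearMap (fderiv ℝ F x)

lemma pullbackForm_apply {e : ℕ} (F : EucA d → EucA e) (ω : EucA e → EucA e [⋀^Fin p]→L[ℝ] ℝ)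
    (x : EucA d) (v : Fin p → EucA d) :
    pullbackForm F ω x v = ω (F x) fun i => fderiv ℝ F x (v i) := rfl

lemma contDiff_pullbackForm {e : ℕ} {F : EucA d → EucA e} (hF : ContDiff ℝ (⊤ : ℕ∞) F)
    {ω : EucA e → EucA e [⋀^Fin p]→L[ℝ] ℝ} (hω : ContDiff ℝ 1 ω) :
    ContDiff ℝ 1 (pullbackForm F ω) := by
  refine contDiff_of_apply fun v => ?_
  refine ContDiff.form_apply (hω.comp (hF.of_le (by simp))) fun i => ?_
  exact (hF.fderiv_right (m := 1) (by rw [one_add_one_eq_two]; exact two_le_smooth)).clm_apply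
    contDiff_const

lemma extDeriv_pullbackForm {e : ℕ} {F : EucA d → EucA e} (hF : ContDiff ℝ (⊤ : ℕ∞) F)
    {ω : EucA e → EucA e [⋀^Fin p]→L[ℝ] ℝ} (hω : ContDiff ℝ 1 ω) :
    extDeriv (pullbackForm F ω) = pullbackForm F (extDeriv ω) := by
  funext x
  exact extDeriv_pullback (r := (⊤ : ℕ∞)) (hω.differentiable one_ne_zero _) hF.contDiffAt
    (by rw [minSmoothness_of_isRCLikeNormedField]; exact two_le_smooth)

/-- Averaging a wedge product over rotations only sees the elementary pairing. -/
lemma integral_wedgeEval {x : EucA d} {v : Fin (p + q) → EucA d} (h : SphereFrame x v)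
    {α : EucA d → EucA d [⋀^Fin p]→L[ℝ] ℝ} {β : EucA d → EucA d [⋀^Fin q]→L[ℝ] ℝ}
    (hα : Continuous α) (hβ : Continuous β) :
    ∫ g, wedgeEval p q (fun w => α (g x) w) (fun w => β (g x) w) (fun i => g (v i))
      ∂rotMeasure d = ((p + q).factorial : ℝ) / ((p.factorial : ℝ) * (q.factorial : ℝ)) *
        pairing x (fun i => v (Fin.castAdd q i)) (fun j => v (Fin.natAdd p j)) α β := by
  let Q : EucA d → (Fin (p + q) → EucA d) → ℝ := fun x w =>
    α x (fun i => w (Fin.castAdd q i)) * β x fun j => w (Fin.natAdd p j)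
  have hQ : ∀ (x : EucA d) (v : Fin (p + q) → EucA d),
      Continuous fun g : EucA d →L[ℝ] EucA d => Q (g x) fun i => g (v i) := by
    intro x v
    simp only [Q]
    fun_prop
  have hneg : ∀ (x : EucA d) (v : Fin (p + q) → EucA d) (j : Fin (p + q)),
      Q x (Function.update v j (-(v j))) = -Q x v := by
    intro x v j
    refine Fin.addCases (fun j => ?_) (fun j => ?_) j
    · have e : (fun i : Fin p => Function.update v (Fin.castAdd q j) (-(v (Fin.castAdd q j)))
          (Fin.castAdd q i)) = Function.update (fun i : Fin p => v (Fin.castAdd q i)) j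
            (-(v (Fin.castAdd q j))) := by
        funext i
        simp [Function.update_apply]
      have e' : (fun i : Fin q => Function.update v (Fin.castAdd q j) (-(v (Fin.castAdd q j)))
          (Fin.natAdd p i)) = fun i => v (Fin.natAdd p i) := by
        funext i
        have : Fin.natAdd p i ≠ Fin.castAdd q j := by
          simp [Fin.ext_iff]
          omega
        simp [this]
      simp only [Q, e, e']
      rw [update_neg_alternating _ (fun i : Fin p => v (Fin.castAdd q i)) j]
      ring
    · have e : (fun i : Fin q => Function.update v (Fin.natAdd p j) (-(v (Fin.natAdd p j)))
          (Fin.natAdd p i)) = Function.update (fun i : Fin q => v (Fin.natAdd p i)) j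
            (-(v (Fin.natAdd p j))) := by
        funext i
        simp [Function.update_apply]
      have e' : (fun i : Fin p => Function.update v (Fin.natAdd p j) (-(v (Fin.natAdd p j)))
          (Fin.castAdd q i)) = fun i => v (Fin.castAdd q i) := by
        funext i
        have : Fin.castAdd q i ≠ Fin.natAdd p j := by
          simp [Fin.ext_iff]
          omega
        simp [this]
      simp only [Q, e, e']
      rw [update_neg_alternating _ (fun i : Fin q => v (Fin.natAdd p i)) j]
      ring
  have h1 : ∀ σ : Equiv.Perm (Fin (p + q)), ∫ g, ((Equiv.Perm.sign σ : ℤ) : ℝ) *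
      Q (g x) (fun i => g (v (σ i))) ∂rotMeasure d =
      ∫ g, Q (g x) (fun i => g (v i)) ∂rotMeasure d := by
    intro σ
    rw [integral_const_mul, integral_perm_frame hQ hneg h, ← mul_assoc]
    have : ((Equiv.Perm.sign σ : ℤ) : ℝ) * ((Equiv.Perm.sign σ : ℤ) : ℝ) = 1 := by
      rw [← Int.cast_mul, ← Units.val_mul, Int.units_mul_self]
      simp
    rw [this, one_mul]
  have h2 : ∀ g : EucA d →L[ℝ] EucA d, wedgeEval p q (fun w => α (g x) w) (fun w => β (g x) w)
      (fun i => g (v i)) = ((p.factorial * q.factorial : ℕ) : ℝ)⁻¹ *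
        ∑ σ : Equiv.Perm (Fin (p + q)), ((Equiv.Perm.sign σ : ℤ) : ℝ) *
          Q (g x) (fun i => g (v (σ i))) := fun g => rfl
  simp only [h2]
  rw [integral_const_mul, integral_finsetSum]
  · simp only [h1]
    rw [Finset.sum_const, Finset.card_univ, Fintype.card_perm, Fintype.card_fin, nsmul_eq_mul]
    rw [pairing, Nat.cast_mul]
    simp only [Q]
    ring
  · intro σ _
    exact integrable_rot (continuous_const.mul (hQ x fun i => v (σ i)))

/-- Pairings of forms that factor through a space of too small dimension vanish. -/
lemma pairing_eq_zero_of_wedge {x : EucA d} {v : Fin (p + q) → EucA d} (h : SphereFrame x v)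
    {α : EucA d → EucA d [⋀^Fin p]→L[ℝ] ℝ} {β : EucA d → EucA d [⋀^Fin q]→L[ℝ] ℝ}
    (hα : Continuous α) (hβ : Continuous β)
    (h0 : ∀ g ∈ rotationSet d,
      wedgeEval p q (fun w => α (g x) w) (fun w => β (g x) w) (fun i => g (v i)) = 0) :
    pairing x (fun i => v (Fin.castAdd q i)) (fun j => v (Fin.natAdd p j)) α β = 0 := by
  have h1 := integral_wedgeEval h hα hβ
  rw [integral_congr_ae ((rotMeasure_ae d).mono fun g hg => h0 g hg), integral_zero] at h1
  have h2 : ((p + q).factorial : ℝ) / ((p.factorial : ℝ) * (q.factorial : ℝ)) ≠ 0 := by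
    positivity
  exact (mul_eq_zero.1 h1.symm).resolve_left h2

end

section

variable {d : ℕ} {p q : ℕ}

/-- The contraction of the pullback of `β` under `A` with the velocity field `A'`. -/
def homotopyForm (β : EucA d → EucA d [⋀^Fin (p + 1)]→L[ℝ] ℝ) (A A' : EucA d →L[ℝ] EucA d)
    (y : EucA d) : EucA d [⋀^Fin p]→L[ℝ] ℝ :=
  ((β (A y)).curryLeft (A' y)).compContinuousLinearMap A

lemma contDiff_homotopyForm {X : Type*} [NormedAddCommGroup X] [NormedSpace ℝ X]
    {n : WithTop ℕ∞} {β : EucA d → EucA d [⋀^Fin (p + 1)]→L[ℝ] ℝ}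
    (hβ : ContDiff ℝ n β) {A A' : X → EucA d →L[ℝ] EucA d} {y : X → EucA d}
    (hA : ContDiff ℝ n A) (hA' : ContDiff ℝ n A') (hy : ContDiff ℝ n y) :
    ContDiff ℝ n fun s => homotopyForm β (A s) (A' s) (y s) := by
  refine contDiff_of_apply fun v => ?_
  refine ContDiff.form_apply (hβ.comp (hA.clm_apply hy))
    (v := fun i s => (Fin.cons (A' s (y s)) fun j => A s (v j) : Fin (p + 1) → EucA d) i)
    fun i => ?_
  refine Fin.cases ?_ (fun i => ?_) i
  · simpa using hA'.clm_apply hy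
  · simpa using hA.clm_apply contDiff_const

/-- Cartan's formula. -/
lemma extDeriv_homotopyForm {β : EucA d → EucA d [⋀^Fin (p + 1)]→L[ℝ] ℝ} (hβ : ContDiff ℝ 1 β)
    (A A' : EucA d →L[ℝ] EucA d) (y : EucA d) (v : Fin (p + 1) → EucA d) :
    extDeriv (homotopyForm β A A') y v +
      extDeriv β (A y) (fun i => (Fin.cons (A' y) fun j => A (v j) : Fin (p + 2) → EucA d) i) =
      fderiv ℝ β (A y) (A' y) (fun j => A (v j)) +
        ∑ i, β (A y) (Function.update (fun j => A (v j)) i (A' (v i))) := by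
  have hθ : ContDiff ℝ 1 (homotopyForm β A A') :=
    contDiff_homotopyForm hβ contDiff_const contDiff_const contDiff_id
  rw [extDeriv_apply (hθ.differentiable one_ne_zero y)]
  have h1 : ∀ i : Fin (p + 1), fderiv ℝ (fun x => homotopyForm β A A' x (i.removeNth v)) y (v i) =
      fderiv ℝ β (A y) (A (v i)) (fun k => (Fin.cons (A' y) (i.removeNth fun j => A (v j)) :
        Fin (p + 1) → EucA d) k) +
      β (A y) (fun k => (Fin.cons (A' (v i)) (i.removeNth fun j => A (v j)) :
        Fin (p + 1) → EucA d) k) := by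
    intro i
    have hb := ((hβ.differentiable one_ne_zero (A y)).hasFDerivAt).comp y A.hasFDerivAt
    have hg : ∀ k : Fin (p + 1), HasFDerivAt (fun x : EucA d => (Fin.cons (A' x)
        (i.removeNth fun j => A (v j)) : Fin (p + 1) → EucA d) k)
        ((Fin.cons A' (fun _ => 0) : Fin (p + 1) → EucA d →L[ℝ] EucA d) k) y := by
      intro k
      refine Fin.cases ?_ (fun k => ?_) k
      · simpa using A'.hasFDerivAt
      · simpa using hasFDerivAt_const _ _
    have h2 := hb.continuousAlternatingMap_apply hg
    have h3 : (fun x => homotopyForm β A A' x (i.removeNth v)) = fun x => (β ∘ A) x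
      fun k => (Fin.cons (A' x) (i.removeNth fun j => A (v j)) : Fin (p + 1) → EucA d) k := rfl
    rw [h3, h2.fderiv]
    simp only [add_apply, ContinuousLinearMap.comp_apply, sum_apply,
      ContinuousAlternatingMap.apply_apply, Function.comp_apply]
    rw [Fin.sum_univ_succ]
    simp
  have h4 : ∀ i : Fin (p + 1), (-1 : ℤ) ^ (i : ℕ) • β (A y) (fun k => (Fin.cons (A' (v i))
      (i.removeNth fun j => A (v j)) : Fin (p + 1) → EucA d) k) =
      β (A y) (Function.update (fun j => A (v j)) i (A' (v i))) := by
    intro i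
    have h5 := (β (A y)).map_insertNth i (A' (v i)) (i.removeNth fun j => A (v j))
    rw [Fin.insertNth_removeNth] at h5
    exact h5.symm
  simp only [h1, smul_add, Finset.sum_add_distrib, h4]
  rw [extDeriv, ContinuousAlternatingMap.alternatizeUncurryFin_apply,
    Fin.sum_univ_succ (n := p + 1)]
  have h6 : ∀ i : Fin (p + 1), (i.succ.removeNth fun k => (Fin.cons (A' y) fun j => A (v j) :
      Fin (p + 2) → EucA d) k) = fun k => (Fin.cons (A' y) (i.removeNth fun j => A (v j)) :
        Fin (p + 1) → EucA d) k := by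
    intro i
    funext k
    refine Fin.cases ?_ (fun k => ?_) k
    · simp [Fin.removeNth]
    · simp [Fin.removeNth]
  simp only [Fin.val_zero, pow_zero, one_smul, Fin.cons_zero, Fin.val_succ, Fin.cons_succ, h6,
    pow_succ, mul_neg, mul_one, neg_smul, Finset.sum_neg_distrib]
  have h7 : ((0 : Fin (p + 2)).removeNth fun k => (Fin.cons (A' y) fun j => A (v j) :
      Fin (p + 2) → EucA d) k) = fun j => A (v j) := by
    funext k
    simp [Fin.removeNth]
  rw [h7]
  ring

lemma hasDerivAt_pull {β : EucA d → EucA d [⋀^Fin (p + 1)]→L[ℝ] ℝ} (hβ : ContDiff ℝ 1 β)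
    {A : ℝ → EucA d →L[ℝ] EucA d} {A' : EucA d →L[ℝ] EucA d} {t : ℝ} (hA : HasDerivAt A A' t)
    (y : EucA d) (v : Fin (p + 1) → EucA d) :
    HasDerivAt (fun t => β (A t y) fun j => A t (v j))
      (extDeriv (homotopyForm β (A t) A') y v + extDeriv β (A t y)
        (fun i => (Fin.cons (A' y) fun j => A t (v j) : Fin (p + 2) → EucA d) i)) t := by
  have hA2 : ∀ z, HasDerivAt (fun t => A t z) (A' z) t := fun z => by
    simpa using hA.clm_apply (hasDerivAt_const t z)
  rw [extDeriv_homotopyForm hβ]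
  have hb := (((hβ.differentiable one_ne_zero (A t y)).hasFDerivAt).comp_hasDerivAt t
    (hA2 y)).hasFDerivAt
  have h2 := (hb.continuousAlternatingMap_apply (fun j => (hA2 (v j)).hasFDerivAt)).hasDerivAt
  refine h2.congr_deriv ?_
  simp [sum_apply]

/-- The value of a form on a frame one of whose vectors is replaced by a tangent vector. -/
lemma abs_form_cons_le {ψ : EucA d [⋀^Fin (p + 1)]→L[ℝ] ℝ} {K : ℝ} (hK : 0 ≤ K) {z w : EucA d}
    {e : Fin p → EucA d} (h : SphereFrame z e) (hψ : ∀ v, SphereFrame z v → |ψ v| ≤ K)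
    (hw : ⟪w, z⟫ = 0) (hw1 : ‖w‖ ≤ 1) :
    |ψ fun i => (Fin.cons w e : Fin (p + 1) → EucA d) i| ≤ K := by
  have he := orthonormal_iff_ite.1 h.orthonormal
  set w' := w - ∑ i, ⟪e i, w⟫ • e i with hw'
  have h0 : ∀ i, ψ.curryLeft (e i) e = 0 := by
    intro i
    rw [ContinuousAlternatingMap.curryLeft_apply_apply]
    refine ψ.map_eq_zero_of_eq _ (i := 0) (j := i.succ) ?_ (Fin.succ_ne_zero i).symm
    simp
  have h1 : ψ.curryLeft w e = ψ.curryLeft w' e := by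
    rw [hw', map_sub, map_sum]
    simp [h0]
  have hort : ∀ i, ⟪e i, w'⟫ = 0 := by
    intro i
    rw [hw', inner_sub_right, inner_sum]
    simp [real_inner_smul_right, he]
  have hort_right : ∀ i, ⟪w', e i⟫ = 0 := fun i => by rw [real_inner_comm]; exact hort i
  have hn : ‖w'‖ ≤ ‖w‖ := by
    have h2 : ⟪w', w⟫ = ⟪w', w'⟫ := by
      conv_rhs => rw [hw', inner_sub_right, inner_sum, ← hw']
      simp [real_inner_smul_right, hort_right]
    rw [real_inner_self_eq_norm_sq] at h2
    have h3 := real_inner_le_norm w' w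
    by_contra hc
    push Not at hc
    nlinarith [norm_nonneg w, norm_nonneg w']
  change |ψ.curryLeft w e| ≤ K
  rw [h1]
  by_cases hz : w' = 0
  · rw [hz, map_zero]
    simpa using hK
  have hpos : 0 < ‖w'‖ := norm_pos_iff.2 hz
  have hwz : ⟪w', z⟫ = 0 := by
    rw [hw', inner_sub_left, sum_inner, hw]
    simp [real_inner_smul_left, h.tangent]
  have hfr : SphereFrame z (Fin.cons (‖w'‖⁻¹ • w') e : Fin (p + 1) → EucA d) := by
    refine ⟨h.unit, fun i => ?_, orthonormal_iff_ite.2 fun i j => ?_⟩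
    · refine Fin.cases ?_ (fun i => ?_) i
      · simp [real_inner_smul_left, hwz]
      · simpa using h.tangent i
    · refine Fin.cases ?_ (fun i => ?_) i <;> refine Fin.cases ?_ (fun j => ?_) j
      · rw [Fin.cons_zero, if_pos rfl, real_inner_self_eq_norm_sq, norm_smul, norm_inv, norm_norm,
          inv_mul_cancel₀ hpos.ne', one_pow]
      · simp [real_inner_smul_left, hort_right, (Fin.succ_ne_zero _).symm]
      · simp [real_inner_smul_right, hort]
      · simp [he]
  have h4 : ψ.curryLeft w' e = ‖w'‖ * ψ.curryLeft (‖w'‖⁻¹ • w') e := by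
    rw [map_smul, ContinuousAlternatingMap.smul_apply, smul_eq_mul]
    field_simp
  rw [h4, abs_mul, abs_norm]
  calc ‖w'‖ * |ψ.curryLeft (‖w'‖⁻¹ • w') e| ≤ 1 * K :=
        mul_le_mul (hn.trans hw1) (hψ _ hfr) (abs_nonneg _) zero_le_one
    _ = K := one_mul K

end

section

variable {d : ℕ} {p q : ℕ}

/-- The velocity of the rotations `planeRot u w t ∘L r`. -/
def rotVel (u w : EucA d) (r : EucA d →L[ℝ] EucA d) (t : ℝ) : EucA d →L[ℝ] EucA d :=
  (planeRot u w t ∘L planeGen u w) ∘L r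

lemma OrthoPair.hasDerivAt_comp {u w : EucA d} (h : OrthoPair u w) (r : EucA d →L[ℝ] EucA d)
    (t : ℝ) : HasDerivAt (fun t => planeRot u w t ∘L r) (rotVel u w r t) t := by
  have h1 := (h.hasDerivAt_rot t).clm_comp (hasDerivAt_const t r)
  simpa [rotVel] using h1

lemma contDiff_planeRot (u w : EucA d) : ContDiff ℝ (⊤ : ℕ∞) (planeRot u w) := by
  unfold planeRot
  have h1 : ContDiff ℝ (⊤ : ℕ∞) Real.cos := Real.contDiff_cos
  have h2 : ContDiff ℝ (⊤ : ℕ∞) Real.sin := Real.contDiff_sin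
  fun_prop

lemma contDiff_rotVel (u w : EucA d) (r : EucA d →L[ℝ] EucA d) :
    ContDiff ℝ (⊤ : ℕ∞) (rotVel u w r) :=
  ((contDiff_planeRot u w).clm_comp contDiff_const).clm_comp contDiff_const

lemma OrthoPair.inner_rotVel {u w : EucA d} (h : OrthoPair u w) (r : EucA d →L[ℝ] EucA d)
    (t : ℝ) (y : EucA d) : ⟪rotVel u w r t y, (planeRot u w t ∘L r) y⟫ = 0 := by
  simp only [rotVel, ContinuousLinearMap.comp_apply]
  rw [rotationSet.inner_map (h.rot_mem t), OrthoPair.inner_gen]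

lemma OrthoPair.norm_rotVel_le {u w : EucA d} (h : OrthoPair u w) {r : EucA d →L[ℝ] EucA d}
    (hr : r ∈ rotationSet d) (t : ℝ) (y : EucA d) : ‖rotVel u w r t y‖ ≤ ‖y‖ := by
  simp only [rotVel, ContinuousLinearMap.comp_apply]
  rw [h.norm_rot, ← hr.1 y]
  exact h.norm_gen_le _

/-- Correlation of `β` moved by `r` with `φ`. -/
def correlation (x : EucA d) (a : Fin p → EucA d) (b : Fin q → EucA d)
    (β : EucA d → EucA d [⋀^Fin p]→L[ℝ] ℝ) (φ : EucA d → EucA d [⋀^Fin q]→L[ℝ] ℝ)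
    (r : EucA d →L[ℝ] EucA d) : ℝ :=
  ∫ g, β (r (g x)) (fun i => r (g (a i))) * φ (g x) (fun j => g (b j)) ∂rotMeasure d

lemma continuous_extDeriv {β : EucA d → EucA d [⋀^Fin p]→L[ℝ] ℝ} (hβ : ContDiff ℝ 1 β) :
    Continuous (extDeriv β) :=
  (ContinuousAlternatingMap.alternatizeUncurryFinCLM ℝ (EucA d) ℝ).continuous.comp
    (hβ.continuous_fderiv one_ne_zero)

section estimate

variable {β : EucA d → EucA d [⋀^Fin (p + 1)]→L[ℝ] ℝ} {φ : EucA d → EucA d [⋀^Fin q]→L[ℝ] ℝ}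
  {x : EucA d} {a : Fin (p + 1) → EucA d} {b : Fin q → EucA d} {K : ℝ}

lemma SphereFrame.cons_left (h : SphereFrame x (Sum.elim a b)) :
    SphereFrame x (Fin.cons (a 0) b : Fin (q + 1) → EucA d) := by
  have h3 := h.comp (f := (Fin.cons (Sum.inl 0) fun j => Sum.inr j :
    Fin (q + 1) → Fin (p + 1) ⊕ Fin q)) (by
      intro i j
      refine Fin.cases ?_ (fun i => ?_) i <;> refine Fin.cases ?_ (fun j => ?_) j <;> simp)
  convert h3 using 1
  funext i
  refine Fin.cases ?_ (fun i => ?_) i <;> simp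

lemma pairing_eq_zero_of_frame {θ : EucA d → EucA d [⋀^Fin p]→L[ℝ] ℝ} {a : Fin p → EucA d}
    (hφ : ∀ z v, SphereFrame z v → φ z v = 0) (h : SphereFrame x b) :
    pairing x a b θ φ = 0 := by
  rw [pairing, integral_eq_zero_of_ae]
  filter_upwards [rotMeasure_ae d] with g hg
  rw [hφ _ _ (h.map hg)]
  simp

lemma pairing_exact_eq_zero {θ : EucA d → EucA d [⋀^Fin p]→L[ℝ] ℝ} (hθ : ContDiff ℝ 1 θ)
    (hφ : ContDiff ℝ 1 φ) (hdφ : ∀ z v, SphereFrame z v → extDeriv φ z v = 0)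
    (h : SphereFrame x (Sum.elim a b)) : pairing x a b (extDeriv θ) φ = 0 := by
  have h1 := pairing_extDeriv hθ hφ h
  rw [pairing_eq_zero_of_frame hdφ h.cons_left, mul_zero, neg_zero] at h1
  exact (mul_eq_zero.1 h1).resolve_left (by positivity)

lemma continuous_frame {θ : EucA d → EucA d [⋀^Fin p]→L[ℝ] ℝ} (hθ : Continuous θ)
    (x : EucA d) (a : Fin p → EucA d) :
    Continuous fun g : EucA d →L[ℝ] EucA d => θ (g x) fun i => g (a i) := by
  fun_prop

lemma abs_integral_add_le {P T Q : (EucA d →L[ℝ] EucA d) → ℝ} (hP : Continuous P)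
    (hT : Continuous T) (hQ : Continuous Q) (h0 : ∫ g, P g * Q g ∂rotMeasure d = 0) {K : ℝ}
    (hK : 0 ≤ K) (h1 : ∀ g ∈ rotationSet d, |T g| ≤ K) (h2 : ∀ g ∈ rotationSet d, |Q g| ≤ K) :
    |∫ g, (P g + T g) * Q g ∂rotMeasure d| ≤ K ^ 2 := by
  simp only [add_mul]
  rw [integral_add (integrable_rot (by fun_prop)) (integrable_rot (by fun_prop)), h0, zero_add]
  have h4 : ∀ᵐ g ∂rotMeasure d, ‖T g * Q g‖ ≤ K ^ 2 := by
    filter_upwards [rotMeasure_ae d] with g hg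
    rw [norm_mul, sq]
    exact mul_le_mul (h1 g hg) (h2 g hg) (abs_nonneg _) hK
  simpa using norm_integral_le_of_norm_le_const h4

set_option maxHeartbeats 400000 in
lemma abs_correlation_sub_le (hβ : ContDiff ℝ 1 β) (hφ : ContDiff ℝ 1 φ)
    (hdφ : ∀ z v, SphereFrame z v → extDeriv φ z v = 0) (hK : 0 ≤ K)
    (hKβ : ∀ z v, SphereFrame z v → |extDeriv β z v| ≤ K)
    (hKφ : ∀ z v, SphereFrame z v → |φ z v| ≤ K)
    (h : SphereFrame x (Sum.elim a b)) {r : EucA d →L[ℝ] EucA d} (hr : r ∈ rotationSet d)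
    {u w : EucA d} (hp : OrthoPair u w) {τ : ℝ} (hτ : 0 ≤ τ) :
    |correlation x a b β φ (planeRot u w τ ∘L r) - correlation x a b β φ r| ≤ τ * K ^ 2 := by
  let A : ℝ → EucA d →L[ℝ] EucA d := fun t => planeRot u w t ∘L r
  have hcβ := hβ.continuous
  have hcφ := hφ.continuous
  have hdc := continuous_extDeriv hβ
  have hcA : Continuous A := (continuous_planeRot u w).clm_comp continuous_const
  have hcA' : Continuous (rotVel u w r) := (contDiff_rotVel u w r).continuous
  have hfa : SphereFrame x a := h.comp (f := Sum.inl) Sum.inl_injective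
  have hfb : SphereFrame x b := h.comp (f := Sum.inr) Sum.inr_injective
  let T : ℝ → (EucA d →L[ℝ] EucA d) → ℝ := fun t g => extDeriv β (A t (g x))
    (fun i => (Fin.cons (rotVel u w r t (g x)) fun j => A t (g (a j)) : Fin (p + 2) → EucA d) i)
  have hT : Continuous fun s : ℝ × (EucA d →L[ℝ] EucA d) => T s.1 s.2 := by
    simp only [T]
    have : ∀ i : Fin (p + 2), Continuous fun s : ℝ × (EucA d →L[ℝ] EucA d) =>
        (Fin.cons (rotVel u w r s.1 (s.2 x)) fun j => A s.1 (s.2 (a j)) :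
          Fin (p + 2) → EucA d) i := by
      intro i
      refine Fin.cases ?_ (fun i => ?_) i
      · simp only [Fin.cons_zero]
        fun_prop
      · simp only [Fin.cons_succ]
        fun_prop
    fun_prop
  have hθ : ∀ t, ContDiff ℝ 1 (homotopyForm β (A t) (rotVel u w r t)) := fun t =>
    contDiff_homotopyForm hβ contDiff_const contDiff_const contDiff_id
  let D : ℝ → (EucA d →L[ℝ] EucA d) → ℝ := fun t g =>
    fderiv ℝ β (A t (g x)) (rotVel u w r t (g x)) (fun j => A t (g (a j))) +
      ∑ i, β (A t (g x)) (Function.update (fun j => A t (g (a j))) i (rotVel u w r t (g (a i))))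
  have hDT : ∀ t g, D t g = extDeriv (homotopyForm β (A t) (rotVel u w r t)) (g x)
      (fun j => g (a j)) + T t g := fun t g => (extDeriv_homotopyForm hβ _ _ _ _).symm
  have hD : Continuous fun s : ℝ × (EucA d →L[ℝ] EucA d) => D s.1 s.2 := by
    have h1 : Continuous fun s : ℝ × (EucA d →L[ℝ] EucA d) =>
        fderiv ℝ β (A s.1 (s.2 x)) (rotVel u w r s.1 (s.2 x)) :=
      ((hβ.continuous_fderiv one_ne_zero).comp (by fun_prop)).clm_apply (by fun_prop)
    have h2 : ∀ i, Continuous fun s : ℝ × (EucA d →L[ℝ] EucA d) => Function.update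
        (fun j => A s.1 (s.2 (a j))) i (rotVel u w r s.1 (s.2 (a i))) := fun i =>
      Continuous.update (by fun_prop) i (by fun_prop)
    simp only [D]
    fun_prop
  have hTeq : ∀ t g, T t g = extDeriv β (A t (g x)) (fun i =>
      (Fin.cons (rotVel u w r t (g x)) fun j => A t (g (a j)) : Fin (p + 2) → EucA d) i) :=
    fun _ _ => rfl
  clear_value D T
  have hT' : ∀ t, Continuous (T t) := fun t => hT.comp (Continuous.prodMk_right t)
  have hderiv : ∀ g t, HasDerivAt (fun t => β (A t (g x)) (fun j => A t (g (a j))) *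
      φ (g x) fun j => g (b j)) (D t g * φ (g x) fun j => g (b j)) t := by
    intro g t
    have h1 := hasDerivAt_pull hβ (hp.hasDerivAt_comp r t) (g x) (fun j => g (a j))
    rw [hDT, hTeq]
    exact h1.mul_const (φ (g x) fun j => g (b j))
  have key := integral_sub_eq_intervalIntegral hderiv (fun t => by fun_prop) (by fun_prop) hτ
  have e0 : A 0 = r := by
    simp only [A, planeRot_zero]
    rfl
  have hbound : ∀ t, |∫ g, D t g * φ (g x) (fun j => g (b j)) ∂rotMeasure d| ≤ K ^ 2 := by
    intro t
    have hdθ := continuous_extDeriv (hθ t)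
    simp only [hDT]
    refine abs_integral_add_le
      (P := fun g => extDeriv (homotopyForm β (A t) (rotVel u w r t)) (g x) fun j => g (a j))
      (T := T t) (Q := fun g => φ (g x) fun j => g (b j))
      (continuous_frame hdθ x a) (hT' t) (continuous_frame hcφ x b)
      (pairing_exact_eq_zero (hθ t) hφ hdφ h) hK ?_ fun g hg => hKφ _ _ (hfb.map hg)
    intro g hg
    have hA : A t ∈ rotationSet d := rotationSet.comp_mem (hp.rot_mem t) hr
    rw [hTeq]
    have hw : ‖rotVel u w r t (g x)‖ ≤ 1 :=
      (hp.norm_rotVel_le hr t _).trans (hfa.map hg).norm_base.le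
    exact abs_form_cons_le (ψ := extDeriv β (A t (g x)))
      (e := fun j => A t (g (a j))) hK ((hfa.map hg).map hA) (hKβ _)
      (hp.inner_rotVel r t (g x)) hw
  simp only [correlation]
  rw [e0] at key
  change |(∫ g, β (A τ (g x)) (fun i => A τ (g (a i))) * φ (g x) (fun j => g (b j))
    ∂rotMeasure d) - _| ≤ _
  rw [key]
  have h5 := intervalIntegral.norm_integral_le_of_norm_le_const (a := 0) (b := τ) (C := K ^ 2)
    (f := fun t => ∫ g, D t g * φ (g x) (fun j => g (b j)) ∂rotMeasure d) (fun t _ => hbound t)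
  rw [sub_zero, abs_of_nonneg hτ, mul_comm] at h5
  exact h5

lemma abs_correlation_sub_one_le (hβ : ContDiff ℝ 1 β) (hφ : ContDiff ℝ 1 φ)
    (hdφ : ∀ z v, SphereFrame z v → extDeriv φ z v = 0) (hK : 0 ≤ K)
    (hKβ : ∀ z v, SphereFrame z v → |extDeriv β z v| ≤ K)
    (hKφ : ∀ z v, SphereFrame z v → |φ z v| ≤ K)
    (h : SphereFrame x (Sum.elim a b)) (n : ℕ) {r : EucA d →L[ℝ] EucA d} (hr : r ∈ rotWord d n) :
    |correlation x a b β φ r - correlation x a b β φ 1| ≤ n * (2 * Real.pi * K ^ 2) := by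
  induction n generalizing r with
  | zero =>
    obtain rfl : r = 1 := hr
    simp
  | succ n ih =>
    obtain ⟨r', hr', hcase⟩ := hr
    have h1 := ih hr'
    have hpi := Real.pi_pos
    push_cast
    rcases hcase with rfl | ⟨u, w, t, hp, ht0, ht1, rfl⟩
    · have : 0 ≤ 2 * Real.pi * K ^ 2 := by positivity
      linarith
    · have h2 := abs_correlation_sub_le hβ hφ hdφ hK hKβ hKφ h (rotWord_subset n hr') hp ht0
      have h3 : t * K ^ 2 ≤ 2 * Real.pi * K ^ 2 := mul_le_mul_of_nonneg_right ht1 (sq_nonneg K)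
      have h4 := abs_sub_le (correlation x a b β φ (planeRot u w t ∘L r'))
        (correlation x a b β φ r') (correlation x a b β φ 1)
      linarith

lemma integral_frame_eq_zero {y : EucA d} {b : Fin (q + 1) → EucA d}
    {φ : EucA d → EucA d [⋀^Fin (q + 1)]→L[ℝ] ℝ} (hφ : Continuous φ)
    (hfr : SphereFrame x (Fin.cons y b : Fin (q + 2) → EucA d)) :
    ∫ g, φ (g x) (fun j => g (b j)) ∂rotMeasure d = 0 := by
  have hp : OrthoPair y (b 0) := by
    simpa using hfr.orthoPair (i := 0) (j := 1) (by simp)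
  have hv := orthonormal_iff_ite.1 hfr.orthonormal
  have h1 := integral_comp_right (hp.rot_mem Real.pi)
    (f := fun g : EucA d →L[ℝ] EucA d => φ (g x) fun j => g (b j)) (by fun_prop)
  have hx : planeRot y (b 0) Real.pi x = x :=
    OrthoPair.rot_of_ortho (by simpa using hfr.tangent 0) (by simpa using hfr.tangent 1) _
  have hb : ∀ g : EucA d →L[ℝ] EucA d, (fun j => g (planeRot y (b 0) Real.pi (b j))) =
      Function.update (fun j => g (b j)) 0 (-(g (b 0))) := by
    intro g
    funext j
    by_cases hj : j = 0
    · subst hj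
      simp [hp.rot_right]
    · rw [Function.update_of_ne hj, OrthoPair.rot_of_ortho]
      · simpa using hfr.orthonormal.2 (i := 0) (j := j.succ) (Fin.succ_ne_zero j).symm
      · simpa using hfr.orthonormal.2 (i := (0 : Fin (q + 1)).succ) (j := j.succ)
          (fun h => hj (Fin.succ_injective _ h).symm)
  have h2 : ∀ g : EucA d →L[ℝ] EucA d, φ ((g ∘L planeRot y (b 0) Real.pi) x)
      (fun j => (g ∘L planeRot y (b 0) Real.pi) (b j)) = -φ (g x) fun j => g (b j) := by
    intro g
    simp only [ContinuousLinearMap.comp_apply, hx, hb]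
    exact update_neg_alternating _ (fun j => g (b j)) 0
  simp only [h2, integral_neg] at h1
  linarith

/-- Quantitative bound for the pairing of a primitive with a closed form. -/
theorem abs_pairing_le {φ : EucA d → EucA d [⋀^Fin (q + 1)]→L[ℝ] ℝ} {b : Fin (q + 1) → EucA d}
    (hβ : ContDiff ℝ 1 β) (hφ : ContDiff ℝ 1 φ)
    (hdφ : ∀ z v, SphereFrame z v → extDeriv φ z v = 0) (hK : 0 ≤ K)
    (hKβ : ∀ z v, SphereFrame z v → |extDeriv β z v| ≤ K)
    (hKφ : ∀ z v, SphereFrame z v → |φ z v| ≤ K)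
    (h : SphereFrame x (Sum.elim a b)) :
    |pairing x a b β φ| ≤ d * (2 * Real.pi * K ^ 2) := by
  have hcβ := hβ.continuous
  have hcφ := hφ.continuous
  have hint : Integrable (fun s : (EucA d →L[ℝ] EucA d) × (EucA d →L[ℝ] EucA d) =>
      β (s.1 (s.2 x)) (fun i => s.1 (s.2 (a i))) * φ (s.2 x) (fun j => s.2 (b j)))
      ((rotMeasure d).prod (rotMeasure d)) :=
    integrable_prod_of_isCompact rotationSet.isCompact rotationSet.isCompact
      (rotMeasure_restrict d) (rotMeasure_restrict d) (by fun_prop)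
  have hfr := h.cons_left
  have hzero : ∫ r, correlation x a b β φ r ∂rotMeasure d = 0 := by
    simp only [correlation]
    rw [integral_integral_swap hint]
    have h1 : ∀ᵐ g ∂rotMeasure d, ∫ r, β (r (g x)) (fun i => r (g (a i))) *
        φ (g x) (fun j => g (b j)) ∂rotMeasure d =
        (∫ r, β (r x) (fun i => r (a i)) ∂rotMeasure d) * φ (g x) fun j => g (b j) := by
      filter_upwards [rotMeasure_ae d] with g hg
      rw [integral_mul_const]
      congr 1
      exact integral_comp_right hg
        (f := fun r : EucA d →L[ℝ] EucA d => β (r x) fun i => r (a i)) (by fun_prop)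
    rw [integral_congr_ae h1, integral_const_mul, integral_frame_eq_zero hcφ hfr, mul_zero]
  have hone : pairing x a b β φ = correlation x a b β φ 1 := rfl
  have h2 : correlation x a b β φ 1 = ∫ r, (correlation x a b β φ 1 - correlation x a b β φ r)
      ∂rotMeasure d := by
    have hci : Integrable (correlation x a b β φ) (rotMeasure d) := hint.integral_prod_left
    rw [integral_sub (integrable_const _) hci, hzero]
    simp
  have h4 : ∀ᵐ r ∂rotMeasure d, ‖correlation x a b β φ 1 - correlation x a b β φ r‖ ≤
      d * (2 * Real.pi * K ^ 2) := by
    filter_upwards [rotMeasure_ae d] with r hr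
    rw [norm_sub_rev]
    exact abs_correlation_sub_one_le hβ hφ hdφ hK hKβ hKφ h d (rotationSet_subset_rotWord hr)
  rw [hone, h2]
  simpa using norm_integral_le_of_norm_le_const h4

end estimate

end

section

variable {d : ℕ} {p q : ℕ}

section parametric

variable {G : Type*} [NormedAddCommGroup G] [NormedSpace ℝ G]
  {f : ℝ → EucA d → G}

lemma continuous_fderiv_slice (hf : ContDiff ℝ 1 fun s : ℝ × EucA d => f s.1 s.2) :
    Continuous fun s : ℝ × EucA d => fderiv ℝ (f s.1) s.2 := by
  have h1 : ∀ s : ℝ × EucA d, fderiv ℝ (f s.1) s.2 =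
      (fderiv ℝ (fun s : ℝ × EucA d => f s.1 s.2) s) ∘L ContinuousLinearMap.inr ℝ ℝ (EucA d) := by
    intro s
    have h2 := HasFDerivAt.comp (f := fun y => (s.1, y)) s.2
      (hf.differentiable one_ne_zero s).hasFDerivAt (hasFDerivAt_prodMk_right s.1 s.2)
    exact h2.fderiv
  simp only [h1]
  exact (hf.continuous_fderiv one_ne_zero).clm_comp continuous_const

lemma hasFDerivAt_intervalIntegral (hf : ContDiff ℝ 1 fun s : ℝ × EucA d => f s.1 s.2)
    (a b : ℝ) (y : EucA d) :
    HasFDerivAt (fun y => ∫ t in a..b, f t y) (∫ t in a..b, fderiv ℝ (f t) y) y := by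
  have hc := continuous_fderiv_slice hf
  have hcf := hf.continuous
  have hc1 : ∀ y, Continuous fun t => f t y := fun y =>
    hcf.comp (by fun_prop : Continuous fun t : ℝ => (t, y))
  have hc2 : ∀ y, Continuous fun t => fderiv ℝ (f t) y := fun y =>
    hc.comp (by fun_prop : Continuous fun t : ℝ => (t, y))
  obtain ⟨C, hC⟩ := (isCompact_uIcc (a := a) (b := b)).prod (isCompact_closedBall y 1)
    |>.exists_bound_of_continuousOn hc.continuousOn
  refine intervalIntegral.hasFDerivAt_integral_of_dominated_of_fderiv_le
    (F' := fun y t => fderiv ℝ (f t) y) (bound := fun _ => C)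
    (Metric.closedBall_mem_nhds y one_pos) ?_ ((hc1 y).intervalIntegrable _ _)
    ((hc2 y).aestronglyMeasurable) ?_ intervalIntegrable_const ?_
  · exact Filter.Eventually.of_forall fun y => (hc1 y).aestronglyMeasurable
  · exact Filter.Eventually.of_forall fun t ht y hy => hC (t, y) ⟨uIoc_subset_uIcc ht, hy⟩
  · refine Filter.Eventually.of_forall fun t ht y hy => ?_
    have h3 : ContDiff ℝ 1 (f t) := hf.comp (contDiff_const.prodMk contDiff_id)
    exact (h3.differentiable one_ne_zero y).hasFDerivAt

lemma contDiff_intervalIntegral (hf : ContDiff ℝ 1 fun s : ℝ × EucA d => f s.1 s.2)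
    (a b : ℝ) : ContDiff ℝ 1 fun y => ∫ t in a..b, f t y := by
  rw [contDiff_one_iff_fderiv]
  refine ⟨fun y => (hasFDerivAt_intervalIntegral hf a b y).differentiableAt, ?_⟩
  have h1 : (fderiv ℝ fun y => ∫ t in a..b, f t y) = fun y => ∫ t in a..b, fderiv ℝ (f t) y :=
    funext fun y => (hasFDerivAt_intervalIntegral hf a b y).fderiv
  rw [h1]
  refine intervalIntegral.continuous_parametric_intervalIntegral_of_continuous' ?_ a b
  exact (continuous_fderiv_slice hf).comp continuous_swap

lemma clm_fderiv_intervalIntegral [CompleteSpace G]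
    (hf : ContDiff ℝ 1 fun s : ℝ × EucA d => f s.1 s.2)
    (a b : ℝ) (y : EucA d) (L : (EucA d →L[ℝ] G) →L[ℝ] ℝ) :
    L (fderiv ℝ (fun y => ∫ t in a..b, f t y) y) = ∫ t in a..b, L (fderiv ℝ (f t) y) := by
  have hc : Continuous fun t => fderiv ℝ (f t) y :=
    (continuous_fderiv_slice hf).comp (by fun_prop : Continuous fun t : ℝ => (t, y))
  rw [L.intervalIntegral_comp_comm (hc.intervalIntegrable _ _),
    (hasFDerivAt_intervalIntegral hf a b y).fderiv]

end parametric

lemma extDeriv_intervalIntegral {θ : ℝ → EucA d → EucA d [⋀^Fin p]→L[ℝ] ℝ}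
    (hθ : ContDiff ℝ 1 fun s : ℝ × EucA d => θ s.1 s.2) (a b : ℝ) (y : EucA d)
    (v : Fin (p + 1) → EucA d) :
    extDeriv (fun y => ∫ t in a..b, θ t y) y v = ∫ t in a..b, extDeriv (θ t) y v :=
  clm_fderiv_intervalIntegral hθ a b y ((ContinuousAlternatingMap.apply ℝ (EucA d) ℝ v).comp
    (ContinuousAlternatingMap.alternatizeUncurryFinCLM ℝ (EucA d) ℝ (n := p)))

lemma continuous_extDeriv_slice {θ : ℝ → EucA d → EucA d [⋀^Fin p]→L[ℝ] ℝ}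
    (hθ : ContDiff ℝ 1 fun s : ℝ × EucA d => θ s.1 s.2) (y : EucA d)
    (v : Fin (p + 1) → EucA d) : Continuous fun t => extDeriv (θ t) y v :=
  ((ContinuousAlternatingMap.apply ℝ (EucA d) ℝ v).comp
    (ContinuousAlternatingMap.alternatizeUncurryFinCLM ℝ (EucA d) ℝ (n := p))).continuous.comp
      ((continuous_fderiv_slice hθ).comp (by fun_prop : Continuous fun t : ℝ => (t, y)))

/-- Alternating forms of degree `k` vanish on `k` vectors orthogonal to a unit vector when
`k` exceeds the dimension of the orthogonal complement. -/
lemma AlternatingMap.eq_zero_of_tangent {d k : ℕ} {x : EucA d} (hx : ⟪x, x⟫ = 1) (hk : d ≤ k)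
    (α : (EucA d) [⋀^Fin k]→ₗ[ℝ] ℝ) {v : Fin k → EucA d} (hv : ∀ i, ⟪v i, x⟫ = 0) : α v = 0 := by
  refine α.map_linearDependent v fun hli => ?_
  have h1 : LinearIndependent ℝ fun i => (⟨v i, by
      rw [Submodule.mem_orthogonal_singleton_iff_inner_left]
      exact hv i⟩ : ((ℝ ∙ x)ᗮ : Submodule ℝ (EucA d))) :=
    LinearIndependent.of_comp (Submodule.subtype _) hli
  have h2 := h1.fintype_card_le_finrank
  have h3 := Submodule.finrank_add_finrank_orthogonal (ℝ ∙ x)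
  rw [finrank_span_singleton (by rintro rfl; simp at hx)] at h3
  simp only [finrank_euclideanSpace, Fintype.card_fin] at h2 h3
  omega

lemma extDeriv_eq_zero_of_tangent {k : ℕ} {x : EucA d} (hx : ⟪x, x⟫ = 1) (hk : d ≤ k + 1)
    (α : EucA d → (EucA d) [⋀^Fin k]→L[ℝ] ℝ) (z : EucA d) {v : Fin (k + 1) → EucA d}
    (hv : ∀ i, ⟪v i, x⟫ = 0) :
    extDeriv α z v = 0 :=
  AlternatingMap.eq_zero_of_tangent hx hk (extDeriv α z).toAlternatingMap hv

/-- Pullbacks of a top-degree form of the sphere under a rotation differ from the form by an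
exact form. -/
lemma exists_primitive_planeRot {k : ℕ} (hk : d ≤ k + 2)
    {ω : EucA d → (EucA d) [⋀^Fin (k + 1)]→L[ℝ] ℝ} (hω : ContDiff ℝ 1 ω)
    {u w : EucA d} (hp : OrthoPair u w) {r : EucA d →L[ℝ] EucA d} (hr : r ∈ rotationSet d)
    (τ : ℝ) : ∃ η : EucA d → (EucA d) [⋀^Fin k]→L[ℝ] ℝ, ContDiff ℝ 1 η ∧
      ∀ x v, ⟪x, x⟫ = 1 → (∀ i, ⟪v i, x⟫ = 0) → extDeriv η x v =
        ω (planeRot u w τ (r x)) (fun i => planeRot u w τ (r (v i))) -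
          ω (r x) fun i => r (v i) := by
  let θ : ℝ → EucA d → (EucA d) [⋀^Fin k]→L[ℝ] ℝ := fun t y =>
    homotopyForm ω (planeRot u w t ∘L r) (rotVel u w r t) y
  have hθ : ContDiff ℝ 1 fun s : ℝ × EucA d => θ s.1 s.2 := by
    refine contDiff_homotopyForm hω ?_ ?_ contDiff_snd
    · exact (((contDiff_planeRot u w).of_le (by simp)).comp contDiff_fst).clm_comp contDiff_const
    · exact ((contDiff_rotVel u w r).of_le (by simp)).comp contDiff_fst
  refine ⟨fun y => ∫ t in (0 : ℝ)..τ, θ t y, contDiff_intervalIntegral hθ 0 τ, ?_⟩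
  intro x v hx hv
  rw [extDeriv_intervalIntegral hθ]
  have hd : ∀ t, HasDerivAt (fun t => ω (planeRot u w t (r x)) fun i => planeRot u w t (r (v i)))
      (extDeriv (θ t) x v) t := by
    intro t
    have h1 := hasDerivAt_pull hω (hp.hasDerivAt_comp r t) x v
    have hA : planeRot u w t ∘L r ∈ rotationSet d := rotationSet.comp_mem (hp.rot_mem t) hr
    refine h1.congr_deriv ?_
    rw [extDeriv_eq_zero_of_tangent (x := (planeRot u w t ∘L r) x) _ hk, add_zero]
    · intro i
      refine Fin.cases ?_ (fun j => ?_) i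
      · exact hp.inner_rotVel r t x
      · simp only [Fin.cons_succ]
        rw [rotationSet.inner_map hA, hv]
    · rw [rotationSet.inner_map hA, hx]
  have hc := continuous_extDeriv_slice hθ x v
  rw [intervalIntegral.integral_eq_sub_of_hasDerivAt (fun t _ => hd t) (hc.intervalIntegrable _ _)]
  simp [planeRot_zero]

lemma exists_primitive_rotWord {k : ℕ} (hk : d ≤ k + 2)
    {ω : EucA d → (EucA d) [⋀^Fin (k + 1)]→L[ℝ] ℝ} (hω : ContDiff ℝ 1 ω) (n : ℕ)
    {r : EucA d →L[ℝ] EucA d} (hr : r ∈ rotWord d n) :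
    ∃ η : EucA d → (EucA d) [⋀^Fin k]→L[ℝ] ℝ, ContDiff ℝ 1 η ∧
      ∀ x v, ⟪x, x⟫ = 1 → (∀ i, ⟪v i, x⟫ = 0) → extDeriv η x v =
        ω (r x) (fun i => r (v i)) - ω x v := by
  induction n generalizing r with
  | zero =>
    obtain rfl : r = 1 := hr
    refine ⟨fun _ => 0, contDiff_const, fun x v _ _ => ?_⟩
    have h0 : extDeriv (fun _ : EucA d => (0 : (EucA d) [⋀^Fin k]→L[ℝ] ℝ)) x = 0 := by
      rw [extDeriv, fderiv_const_apply]
      exact map_zero (ContinuousAlternatingMap.alternatizeUncurryFinCLM ℝ (EucA d) ℝ (n := k))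
    rw [h0]
    simp
  | succ n ih =>
    obtain ⟨r', hr', hcase⟩ := hr
    obtain ⟨η, hη, hdη⟩ := ih hr'
    rcases hcase with rfl | ⟨u, w, t, hp, -, -, rfl⟩
    · exact ⟨η, hη, hdη⟩
    · obtain ⟨η', hη', hdη'⟩ := exists_primitive_planeRot hk hω hp (rotWord_subset n hr') t
      refine ⟨η + η', hη.add hη', fun x v hx hv => ?_⟩
      rw [extDeriv_add (hη.differentiable one_ne_zero x) (hη'.differentiable one_ne_zero x),
        ContinuousAlternatingMap.add_apply, hdη x v hx hv, hdη' x v hx hv]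
      simp

end

section

variable {d : ℕ} {p q : ℕ}

/-- The value of a form on the frame obtained by rotating the standard frame. -/
def frameValue {k : ℕ} (ω : EucA (k + 1) → (EucA (k + 1)) [⋀^Fin k]→L[ℝ] ℝ)
    (g : EucA (k + 1) →L[ℝ] EucA (k + 1)) : ℝ :=
  ω (g (stdVec 0)) fun i => g (stdVec i.succ)

lemma continuous_frameValue {k : ℕ} {ω : EucA (k + 1) → (EucA (k + 1)) [⋀^Fin k]→L[ℝ] ℝ}
    (hω : Continuous ω) : Continuous (frameValue ω) :=
  continuous_frame hω _ _

/-- A top-degree form on the sphere is cohomologous to one that is close to its mean. -/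
theorem exists_close_form {k : ℕ} {ω : EucA (k + 2) → (EucA (k + 2)) [⋀^Fin (k + 1)]→L[ℝ] ℝ}
    (hω : ContDiff ℝ 1 ω) {ε : ℝ} (hε : 0 < ε) :
    ∃ (ω' : EucA (k + 2) → (EucA (k + 2)) [⋀^Fin (k + 1)]→L[ℝ] ℝ)
      (η : EucA (k + 2) → (EucA (k + 2)) [⋀^Fin k]→L[ℝ] ℝ),
      ContDiff ℝ 1 ω' ∧ ContDiff ℝ 1 η ∧
      (∀ x v, ⟪x, x⟫ = 1 → (∀ i, ⟪v i, x⟫ = 0) → extDeriv η x v = ω' x v - ω x v) ∧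
      ∀ g ∈ rotationSet (k + 2),
        |frameValue ω' g - ∫ h, frameValue ω h ∂rotMeasure (k + 2)| < ε := by
  let X := rotationSet (k + 2)
  have hX : CompactSpace X := isCompact_iff_compactSpace.1 rotationSet.isCompact
  let Z : Set C(X, ℝ) := {Φ | ∃ (ω' : EucA (k + 2) → (EucA (k + 2)) [⋀^Fin (k + 1)]→L[ℝ] ℝ)
      (η : EucA (k + 2) → (EucA (k + 2)) [⋀^Fin k]→L[ℝ] ℝ),
      ContDiff ℝ 1 ω' ∧ ContDiff ℝ 1 η ∧
      (∀ x v, ⟪x, x⟫ = 1 → (∀ i, ⟪v i, x⟫ = 0) → extDeriv η x v = ω' x v - ω x v) ∧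
      ∀ g : X, Φ g = frameValue ω' g.1}
  have hZ : Convex ℝ Z := by
    rintro Φ ⟨ω₁, η₁, h1, h2, h3, h4⟩ Ψ ⟨ω₂, η₂, k1, k2, k3, k4⟩ a b ha hb hab
    refine ⟨a • ω₁ + b • ω₂, a • η₁ + b • η₂, (h1.const_smul a).add (k1.const_smul b),
      (h2.const_smul a).add (k2.const_smul b), ?_, ?_⟩
    · intro x v hx hv
      have e1 := h2.differentiable one_ne_zero x
      have e2 := k2.differentiable one_ne_zero x
      rw [extDeriv_add (e1.const_smul a) (e2.const_smul b), extDeriv_smul, extDeriv_smul]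
      obtain rfl : b = 1 - a := by linarith
      simp only [ContinuousAlternatingMap.add_apply, ContinuousAlternatingMap.smul_apply,
        Pi.add_apply, Pi.smul_apply, smul_eq_mul, h3 x v hx hv, k3 x v hx hv]
      ring
    · intro g
      simp [h4, k4, frameValue]
  let Φ : (EucA (k + 2) →L[ℝ] EucA (k + 2)) → C(X, ℝ) := fun r =>
    ⟨fun g => frameValue ω (r ∘L g.1), (continuous_frameValue hω.continuous).comp
      (continuous_const.clm_comp continuous_subtype_val)⟩
  have hΦ : Continuous Φ := by
    refine ContinuousMap.continuous_of_continuous_uncurry _ ?_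
    exact (continuous_frameValue hω.continuous).comp
      (continuous_fst.clm_comp (continuous_subtype_val.comp continuous_snd))
  have hΦZ : ∀ r ∈ rotationSet (k + 2), Φ r ∈ closure Z := by
    intro r hr
    obtain ⟨η, hη, hdη⟩ := exists_primitive_rotWord le_rfl hω (k + 2)
      (rotationSet_subset_rotWord hr)
    refine subset_closure ⟨pullbackForm r ω, η, contDiff_pullbackForm r.contDiff hω, hη, ?_, ?_⟩
    · intro x v hx hv
      rw [hdη x v hx hv, pullbackForm_apply, ContinuousLinearMap.fderiv]
    · intro g
      simp only [frameValue, pullbackForm_apply, ContinuousLinearMap.fderiv]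
      rfl
  have hint : Integrable Φ (rotMeasure (k + 2)) := by
    rw [← rotMeasure_restrict]
    exact hΦ.continuousOn.integrableOn_compact rotationSet.isCompact
  have hmem := hZ.closure.integral_mem isClosed_closure
    ((rotMeasure_ae (k + 2)).mono fun r hr => hΦZ r hr) hint
  obtain ⟨Ψ, ⟨ω', η, h1, h2, h3, h4⟩, hΨ⟩ := Metric.mem_closure_iff.1 hmem ε hε
  refine ⟨ω', η, h1, h2, h3, fun g hg => ?_⟩
  have h5 := (ContinuousMap.dist_lt_iff hε).1 hΨ ⟨g, hg⟩
  have h6 : (∫ r, Φ r ∂rotMeasure (k + 2)) ⟨g, hg⟩ = ∫ h, frameValue ω h ∂rotMeasure (k + 2) := by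
    have h7 := (ContinuousMap.evalCLM ℝ (⟨g, hg⟩ : X)).integral_comp_comm hint
    simp only [ContinuousMap.evalCLM_apply] at h7
    rw [← h7]
    exact integral_comp_right hg (continuous_frameValue hω.continuous)
  rw [h6, h4, dist_comm, Real.dist_eq] at h5
  exact h5

end

section

variable {d : ℕ} {p q : ℕ}

lemma inner_self_of_mem_usph {x : EucA d} (hx : x ∈ usph d) : ⟪x, x⟫ = 1 := by
  rw [real_inner_self_eq_norm_sq, mem_sphere_zero_iff_norm.1 hx, one_pow]

lemma mem_usph_of_inner_self {x : EucA d} (hx : ⟪x, x⟫ = 1) : x ∈ usph d := by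
  rw [real_inner_self_eq_norm_sq] at hx
  refine mem_sphere_zero_iff_norm.2 ?_
  nlinarith [norm_nonneg x]

section pull

variable {e : ℕ} {F : EucA d → EucA e}

/-- The derivative of a map between spheres preserves tangent vectors. -/
lemma inner_fderiv_of_mapsTo (hF : Differentiable ℝ F) (hm : MapsTo F (usph d) (usph e))
    {x v : EucA d} (hx : ⟪x, x⟫ = 1) (hv : ⟪v, x⟫ = 0) : ⟪fderiv ℝ F x v, F x⟫ = 0 := by
  by_cases hv0 : v = 0
  · simp [hv0]
  have hn : ‖v‖ ≠ 0 := norm_ne_zero_iff.2 hv0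
  set w := ‖v‖⁻¹ • v with hw
  have hp : OrthoPair x w := by
    refine ⟨hx, ?_, ?_⟩
    · rw [hw, real_inner_smul_left, real_inner_smul_right, real_inner_self_eq_norm_sq]
      field_simp
    · rw [hw, real_inner_smul_right, real_inner_comm, hv, mul_zero]
  have hrot : ∀ t, planeRot x w t x ∈ usph d := fun t =>
    mem_usph_of_inner_self (by rw [rotationSet.inner_map (hp.rot_mem t), hx])
  have hcurve : HasDerivAt (fun t => planeRot x w t x) w 0 := by
    simp only [hp.rot_left]
    have h1 := ((Real.hasDerivAt_cos 0).smul_const x).add ((Real.hasDerivAt_sin 0).smul_const w)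
    refine h1.congr_deriv ?_
    simp
  have h0 : planeRot x w 0 x = x := by simp [planeRot_zero]
  have h2 : HasDerivAt (fun t => F (planeRot x w t x)) (fderiv ℝ F x w) 0 := by
    refine HasFDerivAt.comp_hasDerivAt (f := fun t => planeRot x w t x) (0 : ℝ) ?_ hcurve
    simp only [h0]
    exact (hF x).hasFDerivAt
  have h3 := h2.inner ℝ h2
  have h4 : (fun t => ⟪F (planeRot x w t x), F (planeRot x w t x)⟫) = fun _ => (1 : ℝ) :=
    funext fun t => inner_self_of_mem_usph (hm (hrot t))
  rw [h4, h0] at h3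
  have h5 := h3.unique (hasDerivAt_const (0 : ℝ) (1 : ℝ))
  have h6 : ⟪fderiv ℝ F x w, F x⟫ = 0 := by
    rw [real_inner_comm (fderiv ℝ F x w)] at h5
    linarith
  have h7 : v = ‖v‖ • w := by rw [hw, smul_smul, mul_inv_cancel₀ hn, one_smul]
  rw [h7, map_smul, real_inner_smul_left, h6, mul_zero]

lemma wedgeEval_eq_zero_of_tangent {z : EucA e} (hz : ⟪z, z⟫ = 1) (hk : e ≤ p + q)
    (α : EucA e [⋀^Fin p]→L[ℝ] ℝ) (β : EucA e [⋀^Fin q]→L[ℝ] ℝ) {v : Fin (p + q) → EucA e}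
    (hv : ∀ i, ⟪v i, z⟫ = 0) : wedgeEval p q (fun w => α w) (fun w => β w) v = 0 := by
  have h1 := wedgeAlt_apply p q α.toAlternatingMap β.toAlternatingMap v
  rw [AlternatingMap.eq_zero_of_tangent hz hk _ hv] at h1
  exact h1.symm

lemma SphereFrame.append {x : EucA d} {a : Fin p → EucA d} {b : Fin q → EucA d}
    (h : SphereFrame x (Sum.elim a b)) : SphereFrame x (Fin.append a b) := by
  have h1 := h.comp (f := finSumFinEquiv.symm) finSumFinEquiv.symm.injective
  convert h1 using 1
  funext i
  refine Fin.addCases (fun i => ?_) (fun i => ?_) i <;> simp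

/-- Pullbacks of forms of total degree above the dimension of the target do not pair. -/
lemma pairing_pullback_eq_zero (hF : ContDiff ℝ (⊤ : ℕ∞) F) (hm : MapsTo F (usph d) (usph e))
    {α : EucA e → EucA e [⋀^Fin p]→L[ℝ] ℝ} {β : EucA e → EucA e [⋀^Fin q]→L[ℝ] ℝ}
    (hα : ContDiff ℝ 1 α) (hβ : ContDiff ℝ 1 β) (hk : e ≤ p + q)
    {x : EucA d} {a : Fin p → EucA d} {b : Fin q → EucA d} (h : SphereFrame x (Sum.elim a b)) :
    pairing x a b (pullbackForm F α) (pullbackForm F β) = 0 := by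
  have h1 := pairing_eq_zero_of_wedge h.append (contDiff_pullbackForm hF hα).continuous
    (contDiff_pullbackForm hF hβ).continuous (fun g hg => by
      have hfr := h.append.map hg
      exact wedgeEval_eq_zero_of_tangent (z := F (g x))
        (inner_self_of_mem_usph (hm hfr.mem_sphere)) hk (α (F (g x))) (β (F (g x)))
        (v := fun i => fderiv ℝ F (g x) (g (Fin.append a b i))) fun i =>
          inner_fderiv_of_mapsTo (hF.differentiable (by simp)) hm hfr.unit (hfr.tangent i))
  simpa using h1

lemma extDeriv_pullbackForm_eq_zero (hF : ContDiff ℝ (⊤ : ℕ∞) F)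
    (hm : MapsTo F (usph d) (usph e)) (he : e ≤ p + 1)
    {ω : EucA e → EucA e [⋀^Fin p]→L[ℝ] ℝ} (hω : ContDiff ℝ 1 ω) {x : EucA d}
    {v : Fin (p + 1) → EucA d} (h : SphereFrame x v) : extDeriv (pullbackForm F ω) x v = 0 := by
  rw [extDeriv_pullbackForm hF hω, pullbackForm_apply]
  exact extDeriv_eq_zero_of_tangent (inner_self_of_mem_usph (hm h.mem_sphere)) he _ _ fun i =>
    inner_fderiv_of_mapsTo (hF.differentiable (by simp)) hm h.unit (h.tangent i)

end pull

lemma pairing_congr_right {x : EucA d} {a : Fin p → EucA d} {b : Fin q → EucA d}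
    {α : EucA d → EucA d [⋀^Fin p]→L[ℝ] ℝ} {φ ψ : EucA d → EucA d [⋀^Fin q]→L[ℝ] ℝ}
    (hb : SphereFrame x b) (h : ∀ z v, SphereFrame z v → φ z v = ψ z v) :
    pairing x a b α φ = pairing x a b α ψ := by
  refine integral_congr_ae ?_
  filter_upwards [rotMeasure_ae d] with g hg
  rw [h _ _ (hb.map hg)]

lemma pairing_add_right {x : EucA d} {a : Fin p → EucA d} {b : Fin q → EucA d}
    {α : EucA d → EucA d [⋀^Fin p]→L[ℝ] ℝ} {φ ψ : EucA d → EucA d [⋀^Fin q]→L[ℝ] ℝ}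
    (hα : Continuous α) (hφ : Continuous φ) (hψ : Continuous ψ) :
    pairing x a b α (φ + ψ) = pairing x a b α φ + pairing x a b α ψ := by
  have h1 := continuous_frame hα x a
  have h2 := continuous_frame hφ x b
  have h3 := continuous_frame hψ x b
  simp only [pairing, Pi.add_apply, ContinuousAlternatingMap.add_apply, mul_add]
  exact integral_add (integrable_rot (h1.mul h2)) (integrable_rot (h1.mul h3))

/-- The pairing does not change when `ω` is replaced by a cohomologous form. -/
lemma pairing_cohomologous {k : ℕ} (hk : 1 ≤ k) {F : EucA d → EucA (k + 2)}
    (hF : ContDiff ℝ (⊤ : ℕ∞) F) (hm : MapsTo F (usph d) (usph (k + 2)))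
    {ω ω' : EucA (k + 2) → (EucA (k + 2)) [⋀^Fin (k + 1)]→L[ℝ] ℝ}
    {η : EucA (k + 2) → (EucA (k + 2)) [⋀^Fin k]→L[ℝ] ℝ} {β : EucA d → EucA d [⋀^Fin k]→L[ℝ] ℝ}
    (hω : ContDiff ℝ 1 ω) (hω' : ContDiff ℝ 1 ω') (hη : ContDiff ℝ 1 η) (hβ : ContDiff ℝ 1 β)
    (hdη : ∀ x v, ⟪x, x⟫ = 1 → (∀ i, ⟪v i, x⟫ = 0) → extDeriv η x v = ω' x v - ω x v)
    (hdβ : ∀ x v, SphereFrame x v → extDeriv β x v = pullbackForm F ω x v)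
    {x : EucA d} {a : Fin k → EucA d} {b : Fin (k + 1) → EucA d}
    (h : SphereFrame x (Sum.elim a b)) :
    pairing x a b (β + pullbackForm F η) (pullbackForm F ω') =
      pairing x a b β (pullbackForm F ω) := by
  have cη := contDiff_pullbackForm hF hη
  have cω := contDiff_pullbackForm hF hω
  have cω' := contDiff_pullbackForm hF hω'
  have hfb : SphereFrame x b := h.comp (f := Sum.inr) Sum.inr_injective
  have h1 : pairing x a b (β + pullbackForm F η) (pullbackForm F ω') =
      pairing x a b β (pullbackForm F ω') := by
    rw [pairing_comm, pairing_add_right cω'.continuous hβ.continuous cη.continuous,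
      pairing_comm x b a _ (pullbackForm F η),
      pairing_pullback_eq_zero hF hm hη hω' (by omega) h, add_zero, pairing_comm]
  have h2 : pairing x a b β (pullbackForm F ω') =
      pairing x a b β (pullbackForm F ω + extDeriv (pullbackForm F η)) := by
    refine pairing_congr_right hfb fun z v hv => ?_
    rw [Pi.add_apply, ContinuousAlternatingMap.add_apply, extDeriv_pullbackForm hF hη,
      pullbackForm_apply, pullbackForm_apply, pullbackForm_apply,
      hdη _ _ (inner_self_of_mem_usph (hm hv.mem_sphere)) fun i =>
        inner_fderiv_of_mapsTo (hF.differentiable (by simp)) hm hv.unit (hv.tangent i)]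
    ring
  have h3 : pairing x a b β (extDeriv (pullbackForm F η)) = 0 := by
    have hfr : SphereFrame x (Sum.elim (Fin.cons (b 0) a : Fin (k + 1) → EucA d)
        fun i : Fin k => b i.succ) := by
      have h4 := h.comp (f := Sum.elim (Fin.cons (Sum.inr 0) fun j => Sum.inl j :
        Fin (k + 1) → Fin k ⊕ Fin (k + 1)) fun i : Fin k => Sum.inr i.succ) (by
          rintro (i | i) (j | j)
          · refine Fin.cases ?_ (fun i => ?_) i <;> refine Fin.cases ?_ (fun j => ?_) j <;> simp
          · refine Fin.cases ?_ (fun i => ?_) i <;> simp [(Fin.succ_ne_zero _).symm]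
          · refine Fin.cases ?_ (fun j => ?_) j <;> simp
          · simp)
      convert h4 using 1
      funext i
      rcases i with i | i
      · refine Fin.cases ?_ (fun i => ?_) i <;> simp
      · simp
    have h5 := pairing_extDeriv hβ cη hfr
    have h6 : pairing x (Fin.cons (b 0) a : Fin (k + 1) → EucA d) (fun i : Fin k => b i.succ)
        (extDeriv β) (pullbackForm F η) = 0 := by
      have hfl : SphereFrame x (Fin.cons (b 0) a : Fin (k + 1) → EucA d) :=
        hfr.comp (f := Sum.inl) Sum.inl_injective
      rw [pairing_comm, pairing_congr_right hfl hdβ, pairing_comm]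
      exact pairing_pullback_eq_zero hF hm hω hη (by omega) hfr
    have h7 : (Fin.cons ((Fin.cons (b 0) a : Fin (k + 1) → EucA d) 0) fun i : Fin k => b i.succ :
        Fin (k + 1) → EucA d) = b := by
      funext i
      refine Fin.cases ?_ (fun i => ?_) i <;> simp
    rw [h6, mul_zero, h7] at h5
    simp only [Fin.cons_succ] at h5
    have h8 : ((k : ℝ) + 1) ≠ 0 := by positivity
    exact (mul_eq_zero.1 (neg_eq_zero.1 h5.symm)).resolve_left h8
  rw [h1, h2, pairing_add_right hβ.continuous cω.continuous (continuous_extDeriv cη), h3, add_zero]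

end

section

variable {d : ℕ} {p q : ℕ}

/-- A top-degree form of the sphere is controlled by the volume of the vectors it is fed with. -/
lemma abs_form_le_sqrt_gram {k : ℕ} (hk : 1 ≤ k) {z : EucA (k + 1)} (hz : ⟪z, z⟫ = 1)
    {ω : EucA (k + 1) → (EucA (k + 1)) [⋀^Fin k]→L[ℝ] ℝ} {C : ℝ}
    (hC : ∀ g ∈ rotationSet (k + 1), |frameValue ω g| ≤ C) {u : Fin k → EucA (k + 1)}
    (hu : ∀ i, ⟪u i, z⟫ = 0) :
    |ω z u| ≤ C * Real.sqrt (Matrix.of fun i j : Fin k => ⟪u i, u j⟫).det := by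
  obtain ⟨g, hg, rfl⟩ := exists_rotation_stdVec hk hz
  have hfr := (SphereFrame.std k).map hg
  set e : Fin k → EucA (k + 1) := fun i => g (stdVec i.succ) with he
  let A : Matrix (Fin k) (Fin k) ℝ := Matrix.of fun i j => ⟪e j, u i⟫
  have hexp : ∀ i, u i = ∑ j, A i j • e j := by
    intro i
    have h1 := hfr.expand (u i)
    rw [real_inner_comm, hu, zero_smul, zero_add] at h1
    exact h1
  have h2 : ω (g (stdVec 0)) u = A.det * frameValue ω g := by
    rw [funext hexp]
    exact alternatingMap_matrix (ω (g (stdVec 0))).toAlternatingMap e A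
  have h3 : (Matrix.of fun i j : Fin k => ⟪u i, u j⟫) = A * A.transpose := by
    ext i j
    rw [Matrix.of_apply, Matrix.mul_apply, hexp j, inner_sum]
    refine Finset.sum_congr rfl fun l _ => ?_
    rw [real_inner_smul_right, real_inner_comm, mul_comm]
    rfl
  rw [h2, h3, Matrix.det_mul, Matrix.det_transpose, Real.sqrt_mul_self_eq_abs, abs_mul, mul_comm]
  exact mul_le_mul_of_nonneg_right (hC g hg) (abs_nonneg _)

lemma sqrt_gram_le {E H : Type*} [NormedAddCommGroup E] [InnerProductSpace ℝ E]
    [NormedAddCommGroup H] [InnerProductSpace ℝ H] {k : ℕ} {A : E →ₗ[ℝ] H} {L : ℝ}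
    (hA : ∀ v, ‖A v‖ ≤ L * ‖v‖) {v : Fin k → E} (hv : Orthonormal ℝ v) :
    Real.sqrt (Matrix.of fun i j : Fin k => ⟪A (v i), A (v j)⟫).det ≤
      Real.sqrt (k.factorial * (L * L) ^ k) := by
  have h0 : ∀ i, ‖A (v i)‖ ≤ L := fun i => by simpa [hv.1 i] using hA (v i)
  refine Real.sqrt_le_sqrt ((le_abs_self _).trans ?_)
  have h1 := Matrix.det_le (A := Matrix.of fun i j : Fin k => ⟪A (v i), A (v j)⟫)
    (abv := AbsoluteValue.abs) (x := L * L) fun i j => by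
      refine (abs_real_inner_le_norm _ _).trans ?_
      exact mul_le_mul (h0 i) (h0 j) (norm_nonneg _) ((norm_nonneg _).trans (h0 i))
  simpa using h1

lemma sqrt_gram_le_lamNorm {E H : Type*} [NormedAddCommGroup E] [InnerProductSpace ℝ E]
    [NormedAddCommGroup H] [InnerProductSpace ℝ H] {k : ℕ} {A : E →ₗ[ℝ] H} {L : ℝ}
    (hA : ∀ v, ‖A v‖ ≤ L * ‖v‖) {v : Fin k → E} (hv : Orthonormal ℝ v) :
    Real.sqrt (Matrix.of fun i j : Fin k => ⟪A (v i), A (v j)⟫).det ≤ lamNorm k A :=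
  le_ciSup (f := fun v : {v : Fin k → E // Orthonormal ℝ v} =>
    Real.sqrt (Matrix.of fun i j : Fin k => ⟪A (v.1 i), A (v.1 j)⟫).det)
    ⟨_, by rintro _ ⟨w, rfl⟩; exact sqrt_gram_le hA w.2⟩ ⟨v, hv⟩

lemma lamNorm_le {E H : Type*} [NormedAddCommGroup E] [InnerProductSpace ℝ E]
    [NormedAddCommGroup H] [InnerProductSpace ℝ H] {k : ℕ} {A : E →ₗ[ℝ] H} {L : ℝ}
    (hA : ∀ v, ‖A v‖ ≤ L * ‖v‖) : lamNorm k A ≤ Real.sqrt (k.factorial * (L * L) ^ k) :=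
  Real.iSup_le (fun v => sqrt_gram_le hA v.2) (Real.sqrt_nonneg _)

lemma lamNorm_nonneg {E H : Type*} [NormedAddCommGroup E] [InnerProductSpace ℝ E]
    [NormedAddCommGroup H] [InnerProductSpace ℝ H] (k : ℕ) (A : E →ₗ[ℝ] H) : 0 ≤ lamNorm k A :=
  Real.iSup_nonneg fun _ => Real.sqrt_nonneg _

lemma kDilation_nonneg {H : Type*} [NormedAddCommGroup H] [InnerProductSpace ℝ H] (k : ℕ)
    (F : EucA d → H) : 0 ≤ kDilation k F :=
  Real.iSup_nonneg fun _ => lamNorm_nonneg _ _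

lemma sqrt_gram_le_kDilation {H : Type*} [NormedAddCommGroup H] [InnerProductSpace ℝ H] {k : ℕ}
    {F : EucA d → H} (hF : ContDiff ℝ 1 F) {x : EucA d} {v : Fin k → EucA d}
    (h : SphereFrame x v) :
    Real.sqrt (Matrix.of fun i j : Fin k => ⟪fderiv ℝ F x (v i), fderiv ℝ F x (v j)⟫).det ≤
      kDilation k F := by
  obtain ⟨L, hL⟩ := (isCompact_usph d).exists_bound_of_continuousOn
    (hF.continuous_fderiv one_ne_zero).continuousOn
  have hA : ∀ (y : usph d) (w : ((ℝ ∙ (y : EucA d))ᗮ : Submodule ℝ (EucA d))),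
      ‖((fderiv ℝ F (y : EucA d)).toLinearMap ∘ₗ ((ℝ ∙ (y : EucA d))ᗮ).subtype) w‖ ≤ L * ‖w‖ :=
    fun y w => ((fderiv ℝ F (y : EucA d)).le_opNorm w).trans
      (mul_le_mul_of_nonneg_right (hL y y.2) (norm_nonneg _))
  have h1 : lamNorm k ((fderiv ℝ F x).toLinearMap ∘ₗ ((ℝ ∙ x)ᗮ).subtype) ≤ kDilation k F :=
    le_ciSup (f := fun x : usph d =>
      lamNorm k ((fderiv ℝ F (x : EucA d)).toLinearMap ∘ₗ ((ℝ ∙ (x : EucA d))ᗮ).subtype))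
      ⟨_, by rintro _ ⟨y, rfl⟩; exact lamNorm_le (hA y)⟩ ⟨x, h.mem_sphere⟩
  have hmem : ∀ i, v i ∈ (ℝ ∙ x)ᗮ := fun i =>
    Submodule.mem_orthogonal_singleton_iff_inner_left.2 (h.tangent i)
  refine le_trans ?_ h1
  exact sqrt_gram_le_lamNorm (A := (fderiv ℝ F x).toLinearMap ∘ₗ ((ℝ ∙ x)ᗮ).subtype)
    (hA ⟨x, h.mem_sphere⟩) (v := fun i => ⟨v i, hmem i⟩)
    (h.orthonormal.codRestrict _ hmem)

lemma abs_pullbackForm_le {k : ℕ} (hk : 1 ≤ k) {F : EucA d → EucA (k + 1)}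
    (hF : ContDiff ℝ (⊤ : ℕ∞) F) (hm : MapsTo F (usph d) (usph (k + 1)))
    {ω : EucA (k + 1) → (EucA (k + 1)) [⋀^Fin k]→L[ℝ] ℝ} {C : ℝ} (hC0 : 0 ≤ C)
    (hC : ∀ g ∈ rotationSet (k + 1), |frameValue ω g| ≤ C) {x : EucA d} {v : Fin k → EucA d}
    (h : SphereFrame x v) : |pullbackForm F ω x v| ≤ C * kDilation k F := by
  rw [pullbackForm_apply]
  refine (abs_form_le_sqrt_gram hk (inner_self_of_mem_usph (hm h.mem_sphere)) hC fun i =>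
    inner_fderiv_of_mapsTo (hF.differentiable (by simp)) hm h.unit (h.tangent i)).trans ?_
  exact mul_le_mul_of_nonneg_left (sqrt_gram_le_kDilation (hF.of_le (by simp)) h) hC0

end

section

/-- The integral of a continuous top-degree form as an average over rotations. -/
lemma sphereFormIntegral_eq_frameValue {k : ℕ} (hk : 1 ≤ k)
    {ω : EucA (k + 1) → (EucA (k + 1)) [⋀^Fin k]→L[ℝ] ℝ} (hω : ContDiff ℝ 1 ω) :
    sphereFormIntegral rfl (k : ℝ) (fun x v => ω x v) =
      (sphMeas k).real univ * ∫ g, frameValue ω g ∂rotMeasure (k + 1) := by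
  refine sphereFormIntegral_eq hk (fun x => (ω x).toAlternatingMap) fun u hu => ?_
  exact (contDiff_zero.1 (ContDiff.form_apply (contDiff_zero.2 hω.continuous) fun i =>
    contDiff_zero.2 (hu i)))

/-- The integral of a wedge product of two forms of complementary degrees as a pairing. -/
lemma sphereFormIntegral_wedgeEval {p q : ℕ} (hpq : 1 ≤ p + q)
    {α : EucA (p + q + 1) → EucA (p + q + 1) [⋀^Fin p]→L[ℝ] ℝ}
    {β : EucA (p + q + 1) → EucA (p + q + 1) [⋀^Fin q]→L[ℝ] ℝ}
    (hα : Continuous α) (hβ : Continuous β) :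
    sphereFormIntegral rfl ((p + q : ℕ) : ℝ)
        (fun x => wedgeEval p q (fun v => α x v) (fun w => β x w)) =
      (sphMeas (p + q)).real univ * (((p + q).factorial : ℝ) / ((p.factorial : ℝ) *
        (q.factorial : ℝ)) * pairing (stdVec 0) (fun i => stdVec (Fin.castAdd q i).succ)
          (fun j => stdVec (Fin.natAdd p j).succ) α β) := by
  rw [← integral_wedgeEval (SphereFrame.std (p + q)) hα hβ]
  have h := sphereFormIntegral_eq hpq
    (fun x => wedgeAlt p q (α x).toAlternatingMap (β x).toAlternatingMap) fun u hu => by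
      simp only [wedgeAlt_apply, wedgeEval]
      refine continuous_const.mul (continuous_finsetSum _ fun σ _ => continuous_const.mul
        (Continuous.mul ?_ ?_))
      · exact contDiff_zero.1 (ContDiff.form_apply (contDiff_zero.2 hα) fun i =>
          contDiff_zero.2 (hu _))
      · exact contDiff_zero.1 (ContDiff.form_apply (contDiff_zero.2 hβ) fun i =>
          contDiff_zero.2 (hu _))
  simp only [wedgeAlt_apply] at h
  exact h

lemma SphereFrame.std_sum (p q : ℕ) :
    SphereFrame (stdVec 0 : EucA (p + q + 1)) (Sum.elim
      (fun i : Fin p => stdVec (Fin.castAdd q i).succ)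
      (fun j : Fin q => stdVec (Fin.natAdd p j).succ)) := by
  have h := (SphereFrame.std (p + q)).comp (finSumFinEquiv (m := p) (n := q)).injective
  convert h using 1
  ext (i | j) <;> rfl

/-- The quadratic bound of the pairing `∫ β ∧ F*ω` by the dilation, for `dβ = F*ω`. -/
lemma abs_pairing_pullback_le {d m : ℕ} {F : EucA d → EucA (m + 3)}
    (hF : ContDiff ℝ (⊤ : ℕ∞) F) (hm : MapsTo F (usph d) (usph (m + 3)))
    {ω : EucA (m + 3) → (EucA (m + 3)) [⋀^Fin (m + 2)]→L[ℝ] ℝ}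
    {β : EucA d → EucA d [⋀^Fin (m + 1)]→L[ℝ] ℝ} (hω : ContDiff ℝ 1 ω) (hβ : ContDiff ℝ 1 β)
    (hM : ∫ g, frameValue ω g ∂rotMeasure (m + 3) ≠ 0)
    (hdβ : ∀ x v, SphereFrame x v → extDeriv β x v = pullbackForm F ω x v)
    {x : EucA d} {a : Fin (m + 1) → EucA d} {b : Fin (m + 2) → EucA d}
    (h : SphereFrame x (Sum.elim a b)) :
    |pairing x a b β (pullbackForm F ω)| ≤ d * (2 * Real.pi *
      (2 * |∫ g, frameValue ω g ∂rotMeasure (m + 3)| * kDilation (m + 2) F) ^ 2) := by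
  obtain ⟨ω', η, hω', hη, hdη, hclose⟩ := exists_close_form hω (abs_pos.2 hM)
  rw [← pairing_cohomologous (by omega) hF hm hω hω' hη hβ hdη hdβ h]
  have hC : ∀ g ∈ rotationSet (m + 3),
      |frameValue ω' g| ≤ 2 * |∫ g, frameValue ω g ∂rotMeasure (m + 3)| := fun g hg => by
    have h1 := abs_sub_abs_le_abs_sub (frameValue ω' g) (∫ g, frameValue ω g ∂rotMeasure (m + 3))
    have h2 := hclose g hg
    linarith
  have hKφ : ∀ z v, SphereFrame z v → |pullbackForm F ω' z v| ≤
      2 * |∫ g, frameValue ω g ∂rotMeasure (m + 3)| * kDilation (m + 2) F := fun z v hz =>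
    abs_pullbackForm_le (by omega) hF hm (by positivity) hC hz
  have hpη := contDiff_pullbackForm hF hη
  refine abs_pairing_le (hβ.add hpη) (contDiff_pullbackForm hF hω')
    (fun z v hz => extDeriv_pullbackForm_eq_zero hF hm le_rfl hω' hz)
    (mul_nonneg (by positivity) (kDilation_nonneg _ _)) (fun z v hz => ?_) hKφ h
  have h3 : extDeriv (β + pullbackForm F η) z v = pullbackForm F ω' z v := by
    rw [extDeriv_add (hβ.differentiable one_ne_zero z) (hpη.differentiable one_ne_zero z),
      ContinuousAlternatingMap.add_apply, hdβ z v hz, extDeriv_pullbackForm hF hη]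
    simp only [pullbackForm_apply]
    rw [hdη _ _ (inner_self_of_mem_usph (hm hz.mem_sphere)) fun i =>
      inner_fderiv_of_mapsTo (hF.differentiable (by simp)) hm hz.unit (hz.tangent i)]
    ring
  rw [h3]
  exact hKφ z v hz

/-- The lower bound on the dilation, with the dimensions as variables. -/
lemma exists_dilation_lower_bound (m : ℕ) :
    ∃ c : ℝ, 0 < c ∧ ∀ {D N : ℕ} (hN : m + 1 + 1 = N) (hD : m + 1 + N + 1 = D) (ρ ρ' : ℝ),
      ρ = N → ρ' = ((m + 1 + N : ℕ) : ℝ) →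
      ∀ F : EucA D → EucA (N + 1), ContDiff ℝ (⊤ : ℕ∞) F → MapsTo F (usph D) (usph (N + 1)) →
      ∀ ω : EucA (N + 1) → AlternatingMap ℝ (EucA (N + 1)) ℝ (Fin N),
        (∀ v, ContDiff ℝ (⊤ : ℕ∞) fun y => ω y v) →
        sphereFormIntegral rfl ρ (fun x v => ω x v) = 1 →
      ∀ β : EucA D → AlternatingMap ℝ (EucA D) ℝ (Fin (m + 1)),
        (∀ v, ContDiff ℝ (⊤ : ℕ∞) fun y => β y v) →
        (∀ x ∈ usph D, ∀ v : Fin (m + 1 + 1) → EucA D,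
          (∀ i, ⟪v i, x⟫ = 0) → extDEval β x v = pbEval F ω x (v ∘ Fin.cast hN.symm)) →
        1 ≤ |sphereFormIntegral hD ρ'
              (fun x => wedgeEval (m + 1) N (fun v => β x v) (fun w => pbEval F ω x w))| →
        c ≤ kDilation N F := by
  set s := (sphMeas (m + 2)).real univ with hs
  set A := (sphMeas (m + 1 + (m + 1 + 1))).real univ * (((m + 1 + (m + 1 + 1)).factorial : ℝ) /
    (((m + 1).factorial : ℝ) * ((m + 1 + 1).factorial : ℝ))) *
      ((m + 1 + (m + 1 + 1) + 1 : ℕ) * (2 * Real.pi * (2 * |s⁻¹|) ^ 2)) with hA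
  have hA0 : 0 ≤ A := by positivity
  refine ⟨(Real.sqrt (A + 1))⁻¹, by positivity, ?_⟩
  rintro D N rfl rfl ρ ρ' rfl rfl F hF hm ω hω hint β hβ hdβ hH
  have hω1 := exists_contDiff_form fun v => (hω v).of_le (show (1 : WithTop ℕ∞) ≤ _ by simp)
  have hβ1 := exists_contDiff_form fun v => (hβ v).of_le (show (1 : WithTop ℕ∞) ≤ _ by simp)
  have h1 := (sphereFormIntegral_eq_frameValue (by omega) hω1).symm.trans hint
  have hM : ∫ g, frameValue (fun y => (ω y).toEuclideanCLM) g ∂rotMeasure (m + 3) = s⁻¹ :=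
    eq_inv_of_mul_eq_one_right h1
  have hM0 : ∫ g, frameValue (fun y => (ω y).toEuclideanCLM) g ∂rotMeasure (m + 3) ≠ 0 :=
    right_ne_zero_of_mul_eq_one h1
  have hdβ' : ∀ x v, SphereFrame x v → extDeriv (fun y => (β y).toEuclideanCLM) x v =
      pullbackForm F (fun y => (ω y).toEuclideanCLM) x v := fun x v hx => by
    rw [← extDEval_eq_extDeriv hβ, hdβ x hx.mem_sphere v hx.tangent]
    rfl
  have h2 := sphereFormIntegral_wedgeEval (by omega) hβ1.continuous
    (contDiff_pullbackForm hF hω1).continuous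
  have h3 := abs_pairing_pullback_le hF hm hω1 hβ1 hM0 hdβ' (SphereFrame.std_sum (m + 1) (m + 2))
  rw [hM] at h3
  have h4 : 1 ≤ A * kDilation (m + 2) F ^ 2 := by
    refine hH.trans ?_
    refine (congrArg abs h2).le.trans ?_
    rw [← mul_assoc, abs_mul, abs_of_nonneg (by positivity)]
    refine (mul_le_mul_of_nonneg_left h3 (by positivity)).trans (le_of_eq ?_)
    rw [hA]
    ring
  have h5 : 1 ≤ (Real.sqrt (A + 1) * kDilation (m + 2) F) ^ 2 := by
    rw [mul_pow, Real.sq_sqrt (by positivity)]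
    nlinarith [sq_nonneg (kDilation (m + 2) F)]
  have h6 : 1 ≤ Real.sqrt (A + 1) * kDilation (m + 2) F := by
    have := kDilation_nonneg (m + 2) F
    exact (one_le_sq_iff₀ (by positivity)).1 h5
  rw [inv_le_iff_one_le_mul₀' (by positivity)]
  exact h6

end

/-- For every `n ≥ 1` there is `c(n) > 0` such that: if `F : S^{4n-1} → S^{2n}` is a smooth
map, `ω` is a smooth `2n`-form on `S^{2n}` with `∫_{S^{2n}} ω = 1`, `β` is a smooth
`(2n-1)`-form on `S^{4n-1}` with `dβ = F*ω` (as forms on the sphere), and the Hopf integral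
satisfies `|∫_{S^{4n-1}} β ∧ F*ω| ≥ 1`, then the `2n`-dilation of `F` is at least `c(n)`.
Here `S^{4n-1} = usph (4n) ⊆ ℝ^{4n}`, `S^{2n} = usph (2n+1) ⊆ ℝ^{2n+1}`; forms on the spheres
are represented by (alternating-map valued) smooth forms on the ambient Euclidean spaces, the
degree of `β` being written as `b` with `b + 1 = 2n`; integrals of top-degree forms are with
respect to the standard orientations of the spheres. -/
theorem dilation_lower_bound_of_hopf_integral (n : ℕ) (hn : 1 ≤ n) :
    ∃ c : ℝ, 0 < c ∧
      ∀ (F : EucA (4 * n) → EucA (2 * n + 1)),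
        ContDiff ℝ (⊤ : ℕ∞) F → MapsTo F (usph (4 * n)) (usph (2 * n + 1)) →
      ∀ ω : EucA (2 * n + 1) → AlternatingMap ℝ (EucA (2 * n + 1)) ℝ (Fin (2 * n)),
        (∀ v, ContDiff ℝ (⊤ : ℕ∞) fun y => ω y v) →
        sphereFormIntegral rfl (2 * n : ℝ) (fun x v => ω x v) = 1 →
      ∀ b : ℕ, ∀ hb : b + 1 = 2 * n,
      ∀ β : EucA (4 * n) → AlternatingMap ℝ (EucA (4 * n)) ℝ (Fin b),
        (∀ v, ContDiff ℝ (⊤ : ℕ∞) fun y => β y v) →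
        (∀ x ∈ usph (4 * n), ∀ v : Fin (b + 1) → EucA (4 * n),
          (∀ i, ⟪v i, x⟫ = 0) → extDEval β x v = pbEval F ω x (v ∘ Fin.cast hb.symm)) →
        1 ≤ |sphereFormIntegral (by omega : b + 2 * n + 1 = 4 * n) ((4 * n : ℝ) - 1)
              (fun x => wedgeEval b (2 * n) (fun v => β x v) (fun w => pbEval F ω x w))| →
        c ≤ kDilation (2 * n) F := by
  obtain ⟨c, hc, h⟩ := exists_dilation_lower_bound (2 * n - 2)
  refine ⟨c, hc, fun F hF hm ω hω hint b hb β hβ hdβ hH => ?_⟩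
  obtain rfl : b = 2 * n - 2 + 1 := by omega
  refine h hb (by omega) (2 * n) (4 * n - 1) (by push_cast; rfl) ?_ F hF hm ω hω hint β hβ hdβ hH
  rw [show 2 * n - 2 + 1 + 2 * n = 4 * n - 1 by omega, Nat.cast_sub (by omega)]
  push_cast
  rfl
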